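/- arXiv:1204.0167 — 3 statements merged into one kernel-verified Lean document; each statement's English description precedes it below -/
import Mathlib

section
/- Let H₀ and H₁ = H₀ + V be self-adjoint matrices on a finite-dimensional Hilbert space, with spectral projections E₀(λ) = χ_{(−∞,λ]}(H₀) and E_s(λ) = χ_{(−∞,λ]}(H₀ + sV) for s ∈ [0,1]. Then for every λ ∈ ℝ and every s ∈ [0,1], Tr(V(E₀(λ) − E_s(λ))) ≥ 0. -/
/-- The spectral projection `χ_{(−∞,t]}(A)` of a Hermitian matrix `A`, defined via the
spectral theorem. -/
noncomputable def specProj {n : ℕ} {A : Matrix (Fin n) (Fin n) ℂ} (hA : A.IsHermitian)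
    (t : ℝ) : Matrix (Fin n) (Fin n) ℂ :=
  (Matrix.IsHermitian.eigenvectorUnitary hA : Matrix (Fin n) (Fin n) ℂ) *
    Matrix.diagonal (fun i => if hA.eigenvalues i ≤ t then (1 : ℂ) else 0) *
    star (Matrix.IsHermitian.eigenvectorUnitary hA : Matrix (Fin n) (Fin n) ℂ)

open Matrix in
theorem specProj_isStarProjection {n : ℕ} {A : Matrix (Fin n) (Fin n) ℂ} (hA : A.IsHermitian)
    (t : ℝ) : IsStarProjection (specProj hA t) := by
  have hU : star (hA.eigenvectorUnitary : Matrix (Fin n) (Fin n) ℂ) * hA.eigenvectorUnitary = 1 :=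
    Unitary.coe_star_mul_self _
  unfold specProj
  set U := (hA.eigenvectorUnitary : Matrix (Fin n) (Fin n) ℂ)
  constructor
  · rw [IsIdempotentElem]
    simp only [Matrix.mul_assoc]
    rw [← Matrix.mul_assoc (star U) U, hU, Matrix.one_mul, ← Matrix.mul_assoc (diagonal _),
      diagonal_mul_diagonal]
    simp only [mul_ite, mul_one, mul_zero, ← ite_and, and_self]
  · rw [IsSelfAdjoint]
    simp only [star_mul, star_star, Matrix.mul_assoc]
    congr 2
    rw [star_eq_conjTranspose, diagonal_conjTranspose]
    congr 1
    ext i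
    simp only [Pi.star_apply]
    split_ifs <;> simp

open scoped ComplexOrder in
theorem IsStarProjection.matrix_diag_re_nonneg {n : ℕ} {Q : Matrix (Fin n) (Fin n) ℂ}
    (hQ : IsStarProjection Q) (i : Fin n) : 0 ≤ (Q i i).re := by
  have h := (Matrix.posSemidef_conjTranspose_mul_self Q).diag_nonneg (i := i)
  rw [← Matrix.star_eq_conjTranspose, hQ.isSelfAdjoint.star_eq, hQ.isIdempotentElem.eq] at h
  exact (Complex.le_def.1 h).1

/-- The spectral projection `χ_{(−∞,t]}(A)` minimizes `Q ↦ Tr((A - t) Q)` among orthogonal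
projections. -/
theorem trace_sub_mul_sub_specProj_re_nonneg {n : ℕ} {A Q : Matrix (Fin n) (Fin n) ℂ}
    (hA : A.IsHermitian) (hQ : IsStarProjection Q) (t : ℝ) :
    0 ≤ (((A - (t : ℂ) • 1) * (Q - specProj hA t)).trace).re := by
  have hspec := hA.spectral_theorem
  rw [Unitary.conjStarAlgAut_apply] at hspec
  have hU : star (hA.eigenvectorUnitary : Matrix (Fin n) (Fin n) ℂ) * hA.eigenvectorUnitary = 1 :=
    Unitary.coe_star_mul_self _
  have hU' : (hA.eigenvectorUnitary : Matrix (Fin n) (Fin n) ℂ) * star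
      (hA.eigenvectorUnitary : Matrix (Fin n) (Fin n) ℂ) = 1 :=
    Unitary.coe_mul_star_self _
  unfold specProj
  set U := (hA.eigenvectorUnitary : Matrix (Fin n) (Fin n) ℂ)
  set P := Matrix.diagonal (fun i => if hA.eigenvalues i ≤ t then (1 : ℂ) else 0)
  set R := star U * Q * U with hR
  have hRproj : IsStarProjection R := by
    constructor
    · calc R * R = star U * Q * (U * star U) * Q * U := by simp only [hR, Matrix.mul_assoc]
        _ = star U * (Q * Q) * U := by rw [hU', Matrix.mul_one]; simp only [Matrix.mul_assoc]
        _ = R := by rw [hQ.isIdempotentElem.eq]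
    · rw [IsSelfAdjoint, hR, star_mul, star_mul, star_star, hQ.isSelfAdjoint.star_eq,
        Matrix.mul_assoc]
  have hQR : Q - U * P * star U = U * (R - P) * star U := by
    have : U * R * star U = (U * star U) * Q * (U * star U) := by
      simp only [hR, Matrix.mul_assoc]
    rw [Matrix.mul_sub, Matrix.sub_mul, this, hU', Matrix.one_mul, Matrix.mul_one]
  have hAt : A - (t : ℂ) • 1 =
      U * Matrix.diagonal (fun i => ((hA.eigenvalues i - t : ℝ) : ℂ)) * star U := by
    have hd : Matrix.diagonal (fun i => ((hA.eigenvalues i - t : ℝ) : ℂ)) =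
        Matrix.diagonal (RCLike.ofReal ∘ hA.eigenvalues) - (t : ℂ) • 1 := by
      rw [Matrix.smul_one_eq_diagonal, Matrix.diagonal_sub]
      congr 1
      ext i
      simp
    rw [hd, Matrix.mul_sub, Matrix.sub_mul, ← hspec, Matrix.mul_smul, Matrix.smul_mul,
      Matrix.mul_one, hU']
  have htr : ((A - (t : ℂ) • 1) * (Q - U * P * star U)).trace =
      (Matrix.diagonal (fun i => ((hA.eigenvalues i - t : ℝ) : ℂ)) * (R - P)).trace := by
    rw [hQR, hAt]
    set D := Matrix.diagonal (fun i => ((hA.eigenvalues i - t : ℝ) : ℂ))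
    calc (U * D * star U * (U * (R - P) * star U)).trace
        = (U * (D * (star U * U) * (R - P)) * star U).trace := by simp only [Matrix.mul_assoc]
      _ = (D * (R - P)).trace := by
        rw [hU, Matrix.mul_one, Matrix.trace_mul_cycle, hU, Matrix.one_mul]
  rw [htr, Matrix.trace, Complex.re_sum]
  refine Finset.sum_nonneg fun i _ => ?_
  have h0 := hRproj.matrix_diag_re_nonneg i
  have h1 := hRproj.one_sub.matrix_diag_re_nonneg i
  simp only [Matrix.sub_apply, Matrix.one_apply_eq, Complex.sub_re, Complex.one_re] at h1
  rw [Matrix.diag_apply, Matrix.diagonal_mul, Complex.re_ofReal_mul, Matrix.sub_apply,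
    Complex.sub_re, show P i i = _ from Matrix.diagonal_apply_eq _ i]
  split_ifs with h
  · rw [Complex.one_re]
    exact mul_nonneg_of_nonpos_of_nonpos (by linarith) (by linarith)
  · rw [Complex.zero_re]
    exact mul_nonneg (by linarith) (by linarith)

theorem Matrix.IsHermitian.trace_mul_im_eq_zero {n : ℕ} {A B : Matrix (Fin n) (Fin n) ℂ}
    (hA : A.IsHermitian) (hB : B.IsHermitian) : ((A * B).trace).im = 0 := by
  rw [← Complex.conj_eq_iff_im, starRingEnd_apply, ← Matrix.trace_conjTranspose,
    Matrix.conjTranspose_mul, hA.eq, hB.eq, Matrix.trace_mul_comm]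

/-- For Hermitian matrices `H₀, V` and `E_s(λ) = χ_{(−∞,λ]}(H₀ + sV)`,
one has `Tr(V(E₀(λ) − E_s(λ))) ≥ 0` (the trace is real and non-negative) for all
`λ ∈ ℝ` and `s ∈ [0,1]`. -/
theorem stmt_5 {n : ℕ} (H₀ V : Matrix (Fin n) (Fin n) ℂ)
    (hH₀ : H₀.IsHermitian) (hV : V.IsHermitian)
    (hs' : ∀ s : ℝ, (H₀ + (s : ℂ) • V).IsHermitian)
    (lam : ℝ) (s : ℝ) (hs : s ∈ Set.Icc (0 : ℝ) 1) :
    0 ≤ ((V * (specProj (hs' 0) lam - specProj (hs' s) lam)).trace).re ∧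
      ((V * (specProj (hs' 0) lam - specProj (hs' s) lam)).trace).im = 0 := by
  have hP := specProj_isStarProjection (hs' 0) lam
  have hQ := specProj_isStarProjection (hs' s) lam
  refine ⟨?_, hV.trace_mul_im_eq_zero (hP.isSelfAdjoint.sub hQ.isSelfAdjoint)⟩
  obtain rfl | hpos := hs.1.eq_or_lt
  · simp
  have h0 := trace_sub_mul_sub_specProj_re_nonneg (hs' 0) hQ lam
  have h1 := trace_sub_mul_sub_specProj_re_nonneg (hs' s) hP lam
  set P := specProj (hs' 0) lam
  set Q := specProj (hs' s) lam
  have hsum : (H₀ + ((0 : ℝ) : ℂ) • V - (lam : ℂ) • 1) * (Q - P) +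
      (H₀ + (s : ℂ) • V - (lam : ℂ) • 1) * (P - Q) = (s : ℂ) • (V * (P - Q)) := by
    rw [← neg_sub P Q, ← Matrix.smul_mul, Complex.ofReal_zero, zero_smul]
    noncomm_ring
  have h := add_nonneg h0 h1
  rw [← Complex.add_re, ← Matrix.trace_add, hsum, Matrix.trace_smul, smul_eq_mul,
    Complex.re_ofReal_mul] at h
  exact nonneg_of_mul_nonneg_right h hpos
end

section
/- Let H and H₀ be self-adjoint matrices on a finite-dimensional Hilbert space with V = H − H₀. Then there exists a non-negative integrable function η supported in a compact interval [a,b] such that for every polynomial p with complex coefficients, Tr(p(H) − p(H₀) − Dp(H₀)·V) = ∫_a^b p''(λ) η(λ) dλ, where Dp(H₀)·V denotes the Fréchet derivative of p at H₀ applied to V; moreover ∫ η = ½‖V‖₂². -/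
open scoped Matrix

/-- The weight `|x - t|` on the interval between `y` and `x`: the Peano kernel of the first-order
Taylor remainder at `x` of an expansion around `y`. -/
noncomputable def taylorKernel (x y : ℝ) : ℝ → ℝ :=
  (Set.uIcc y x).indicator fun t => |x - t|

lemma taylorKernel_nonneg (x y t : ℝ) : 0 ≤ taylorKernel x y t :=
  Set.indicator_nonneg (fun _ _ => abs_nonneg _) t

lemma support_taylorKernel_subset (x y : ℝ) :
    Function.support (taylorKernel x y) ⊆ Set.uIcc y x :=
  Set.support_indicator_subset

lemma integrable_taylorKernel (x y : ℝ) : MeasureTheory.Integrable (taylorKernel x y) := by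
  refine (MeasureTheory.integrable_indicator_iff measurableSet_uIcc).2 ?_
  exact ContinuousOn.integrableOn_compact isCompact_uIcc (by fun_prop)

lemma integral_mul_taylorKernel {a b x y : ℝ} (hx : x ∈ Set.Icc a b) (hy : y ∈ Set.Icc a b)
    (g : ℝ → ℂ) :
    ∫ t in a..b, g t * (taylorKernel x y t : ℂ) = ∫ t in y..x, g t * ((x : ℂ) - t) := by
  have hsub : Set.uIcc y x ⊆ Set.Icc a b := Set.ordConnected_Icc.uIcc_subset hy hx
  have hind : (fun t => g t * (taylorKernel x y t : ℂ)) =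
      (Set.uIcc y x).indicator fun t => g t * ((|x - t| : ℝ) : ℂ) := by
    ext t
    by_cases ht : t ∈ Set.uIcc y x <;> simp [taylorKernel, ht]
  rw [intervalIntegral.integral_of_le (hx.1.trans hx.2),
    ← MeasureTheory.integral_Icc_eq_integral_Ioc, hind,
    MeasureTheory.setIntegral_indicator measurableSet_uIcc, Set.inter_eq_right.2 hsub]
  rcases le_total y x with h | h
  · rw [Set.uIcc_of_le h, intervalIntegral.integral_of_le h,
      ← MeasureTheory.integral_Icc_eq_integral_Ioc]
    refine MeasureTheory.setIntegral_congr_fun measurableSet_Icc fun t ht => ?_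
    simp [abs_of_nonneg (sub_nonneg.2 ht.2)]
  · rw [Set.uIcc_of_ge h, intervalIntegral.integral_of_ge h,
      ← MeasureTheory.integral_Icc_eq_integral_Ioc, ← MeasureTheory.integral_neg]
    refine MeasureTheory.setIntegral_congr_fun measurableSet_Icc fun t ht => ?_
    simp only [abs_of_nonpos (sub_nonpos.2 ht.1)]
    push_cast
    ring

lemma integral_derivative_derivative_mul_taylorKernel {a b x y : ℝ} (hx : x ∈ Set.Icc a b)
    (hy : y ∈ Set.Icc a b) (p : Polynomial ℂ) :
    ∫ t in a..b, p.derivative.derivative.eval (t : ℂ) * (taylorKernel x y t : ℂ) =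
      p.eval (x : ℂ) - p.eval (y : ℂ) - p.derivative.eval (y : ℂ) * (x - y) := by
  rw [integral_mul_taylorKernel hx hy]
  have hderiv (t : ℝ) : HasDerivAt
      (fun t : ℝ => p.derivative.eval (t : ℂ) * ((x : ℂ) - t) + p.eval (t : ℂ))
      (p.derivative.derivative.eval (t : ℂ) * ((x : ℂ) - t)) t := by
    have h := ((p.derivative.hasDerivAt (t : ℂ)).mul
      ((hasDerivAt_id (t : ℂ)).const_sub (x : ℂ))).add (p.hasDerivAt (t : ℂ))
    refine h.comp_ofReal.congr_deriv ?_
    rw [id_eq]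
    ring
  rw [intervalIntegral.integral_eq_sub_of_hasDerivAt (fun t _ => hderiv t)
    (Continuous.intervalIntegrable (by fun_prop) _ _)]
  ring

lemma integral_taylorKernel (x y : ℝ) : ∫ t, taylorKernel x y t = (x - y) ^ 2 / 2 := by
  have hx : x ∈ Set.Icc (min y x) (max y x) := Set.right_mem_uIcc
  have hy : y ∈ Set.Icc (min y x) (max y x) := Set.left_mem_uIcc
  have h := integral_derivative_derivative_mul_taylorKernel hx hy (Polynomial.X ^ 2)
  have hle : min y x ≤ max y x := min_le_max
  rw [intervalIntegral.integral_of_le hle, ← MeasureTheory.integral_Icc_eq_integral_Ioc,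
    MeasureTheory.setIntegral_eq_integral_of_forall_compl_eq_zero] at h
  · simp only [Polynomial.derivative_X_pow, Polynomial.derivative_C_mul, Polynomial.eval_mul,
      Polynomial.eval_C, Polynomial.eval_pow, Polynomial.eval_X] at h
    norm_num at h
    rw [MeasureTheory.integral_const_mul, integral_complex_ofReal] at h
    have h2 : 2 * ∫ t, taylorKernel x y t = x ^ 2 - y ^ 2 - 2 * y * (x - y) := by exact_mod_cast h
    linarith
  · intro t ht
    have : taylorKernel x y t = 0 :=
      Function.notMem_support.1 fun h => ht (support_taylorKernel_subset x y h)
    simp [this]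

namespace Matrix

variable {n : Type*} [Fintype n] [DecidableEq n]

lemma aeval_diagonal (d : n → ℂ) (p : Polynomial ℂ) :
    Polynomial.aeval (diagonal d) p = diagonal fun i => p.eval (d i) := by
  have h := Polynomial.aeval_algHom_apply (diagonalAlgHom (n := n) ℂ (α := ℂ)) d p
  simpa [Polynomial.aeval_pi_apply] using h

lemma IsHermitian.aeval_eq {A : Matrix n n ℂ} (hA : A.IsHermitian) (p : Polynomial ℂ) :
    Polynomial.aeval A p = (hA.eigenvectorUnitary : Matrix n n ℂ) *
      diagonal (fun i => p.eval (hA.eigenvalues i : ℂ)) *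
        (hA.eigenvectorUnitary : Matrix n n ℂ)ᴴ := by
  conv_lhs => rw [hA.spectral_theorem]
  rw [Polynomial.aeval_algHom_apply, aeval_diagonal, Unitary.conjStarAlgAut_apply]
  rfl

/-- The squared overlap of the `i`-th eigenvector of `A` with the `j`-th eigenvector of `B`. -/
noncomputable def IsHermitian.overlap {A B : Matrix n n ℂ} (hA : A.IsHermitian)
    (hB : B.IsHermitian) (i j : n) : ℝ :=
  Complex.normSq (((hA.eigenvectorUnitary : Matrix n n ℂ)ᴴ *
    (hB.eigenvectorUnitary : Matrix n n ℂ)) i j)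

lemma IsHermitian.trace_aeval_mul_aeval {A B : Matrix n n ℂ} (hA : A.IsHermitian)
    (hB : B.IsHermitian) (p q : Polynomial ℂ) :
    (Polynomial.aeval A p * Polynomial.aeval B q).trace =
      ∑ i, ∑ j, (hA.overlap hB i j : ℂ) *
        (p.eval (hA.eigenvalues i : ℂ) * q.eval (hB.eigenvalues j : ℂ)) := by
  rw [hA.aeval_eq, hB.aeval_eq]
  set U := (hA.eigenvectorUnitary : Matrix n n ℂ)
  set W := (hB.eigenvectorUnitary : Matrix n n ℂ)
  set D := diagonal fun i => p.eval (hA.eigenvalues i : ℂ)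
  set E := diagonal fun i => q.eval (hB.eigenvalues i : ℂ)
  have h : (U * D * Uᴴ * (W * E * Wᴴ)).trace = (D * (Uᴴ * W) * (E * (Uᴴ * W)ᴴ)).trace := by
    rw [conjTranspose_mul, conjTranspose_conjTranspose, Matrix.mul_assoc U, Matrix.mul_assoc U,
      trace_mul_comm U]
    simp only [Matrix.mul_assoc]
  rw [h, trace]
  refine Finset.sum_congr rfl fun i _ => ?_
  rw [diag_apply, mul_apply]
  refine Finset.sum_congr rfl fun j _ => ?_
  rw [diagonal_mul, diagonal_mul, conjTranspose_apply, IsHermitian.overlap,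
    Complex.normSq_eq_conj_mul_self]
  simp only [RCLike.star_def]
  ring

lemma trace_sum_pow_mul_mul_pow (A V : Matrix n n ℂ) (p : Polynomial ℂ) :
    (∑ r ∈ p.support, p.coeff r •
      ∑ j ∈ Finset.range r, A ^ (r - j - 1) * V * A ^ j).trace =
      (Polynomial.aeval A p.derivative * V).trace := by
  rw [Polynomial.derivative_apply, Polynomial.sum, map_sum, Finset.sum_mul, trace_sum, trace_sum]
  refine Finset.sum_congr rfl fun r _ => ?_
  have h : ∀ j ∈ Finset.range r,
      (A ^ (r - j - 1) * V * A ^ j).trace = (A ^ (r - 1) * V).trace := by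
    intro j hj
    have hj := Finset.mem_range.1 hj
    rw [trace_mul_cycle, ← pow_add, show j + (r - j - 1) = r - 1 by omega]
  rw [trace_smul, trace_sum, Finset.sum_congr rfl h]
  rw [Polynomial.C_mul_X_pow_eq_monomial, Polynomial.aeval_monomial, ← Algebra.smul_def,
    smul_mul_assoc, trace_smul, Finset.sum_const, Finset.card_range, nsmul_eq_mul, smul_eq_mul,
    smul_eq_mul, mul_assoc]

lemma IsHermitian.trace_taylor_remainder {A B : Matrix n n ℂ} (hA : A.IsHermitian)
    (hB : B.IsHermitian) (p : Polynomial ℂ) :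
    (Polynomial.aeval A p - Polynomial.aeval B p -
      Polynomial.aeval B p.derivative * (A - B)).trace =
      ∑ i, ∑ j, (hA.overlap hB i j : ℂ) *
        (p.eval (hA.eigenvalues i : ℂ) - p.eval (hB.eigenvalues j : ℂ) -
          p.derivative.eval (hB.eigenvalues j : ℂ) *
            ((hA.eigenvalues i : ℂ) - hB.eigenvalues j)) := by
  have h1 := hA.trace_aeval_mul_aeval hB p 1
  have h2 := hA.trace_aeval_mul_aeval hB 1 p
  have h3 := hA.trace_aeval_mul_aeval hB Polynomial.X p.derivative
  have h4 := hA.trace_aeval_mul_aeval hB 1 (p.derivative * Polynomial.X)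
  simp only [map_one, map_mul, mul_one, one_mul, Polynomial.aeval_X, Polynomial.eval_one,
    Polynomial.eval_mul, Polynomial.eval_X] at h1 h2 h3 h4
  rw [Matrix.mul_sub, trace_sub, trace_sub, trace_sub, trace_mul_comm _ A, h1, h2, h3, h4]
  simp only [← Finset.sum_sub_distrib]
  refine Finset.sum_congr rfl fun i _ => Finset.sum_congr rfl fun j _ => ?_
  ring

lemma IsHermitian.sum_overlap_mul_sq {A B : Matrix n n ℂ} (hA : A.IsHermitian)
    (hB : B.IsHermitian) :
    ∑ i, ∑ j, hA.overlap hB i j * (hA.eigenvalues i - hB.eigenvalues j) ^ 2 =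
      (((A - B)ᴴ * (A - B)).trace).re := by
  have h := hA.trace_taylor_remainder hB (Polynomial.X ^ 2)
  have htr : (Polynomial.aeval A (Polynomial.X ^ 2 : Polynomial ℂ) -
      Polynomial.aeval B (Polynomial.X ^ 2 : Polynomial ℂ) -
      Polynomial.aeval B (Polynomial.X ^ 2 : Polynomial ℂ).derivative * (A - B)).trace =
      ((A - B)ᴴ * (A - B)).trace := by
    have hAB : (A * B).trace = (B * A).trace := trace_mul_comm A B
    have h2 : (Polynomial.aeval B (Polynomial.X ^ 2 : Polynomial ℂ).derivative) = (2 : ℂ) • B := by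
      simp [Algebra.algebraMap_eq_smul_one, two_smul, two_mul, one_add_one_eq_two]
    rw [(hA.sub hB).eq, h2, Polynomial.aeval_X_pow, Polynomial.aeval_X_pow]
    simp only [sq, Matrix.mul_sub, Matrix.sub_mul, trace_sub,
      smul_mul_assoc, trace_smul, hAB, smul_eq_mul]
    ring
  rw [← htr, h, ← Complex.ofReal_re (∑ i, ∑ j, _)]
  congr 1
  push_cast
  refine Finset.sum_congr rfl fun i _ => Finset.sum_congr rfl fun j _ => ?_
  simp only [Polynomial.derivative_X_pow, Polynomial.eval_mul, Polynomial.eval_C,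
    Polynomial.eval_pow, Polynomial.eval_X]
  push_cast
  ring

/-- Koplienko's spectral shift function for a pair of Hermitian matrices. -/
noncomputable def IsHermitian.koplienkoShift {A B : Matrix n n ℂ} (hA : A.IsHermitian)
    (hB : B.IsHermitian) (t : ℝ) : ℝ :=
  ∑ i, ∑ j, hA.overlap hB i j * taylorKernel (hA.eigenvalues i) (hB.eigenvalues j) t

lemma IsHermitian.koplienkoShift_nonneg {A B : Matrix n n ℂ} (hA : A.IsHermitian)
    (hB : B.IsHermitian) (t : ℝ) : 0 ≤ hA.koplienkoShift hB t :=
  Finset.sum_nonneg fun _ _ => Finset.sum_nonneg fun _ _ =>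
    mul_nonneg (Complex.normSq_nonneg _) (taylorKernel_nonneg _ _ _)

lemma IsHermitian.integrable_koplienkoShift {A B : Matrix n n ℂ} (hA : A.IsHermitian)
    (hB : B.IsHermitian) : MeasureTheory.Integrable (hA.koplienkoShift hB) :=
  MeasureTheory.integrable_finsetSum _ fun _ _ => MeasureTheory.integrable_finsetSum _ fun _ _ =>
    (integrable_taylorKernel _ _).const_mul _

lemma IsHermitian.integral_koplienkoShift {A B : Matrix n n ℂ} (hA : A.IsHermitian)
    (hB : B.IsHermitian) :
    ∫ t, hA.koplienkoShift hB t = (1 / 2) * (((A - B)ᴴ * (A - B)).trace).re := by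
  have hint (i j : n) : MeasureTheory.Integrable fun t =>
      hA.overlap hB i j * taylorKernel (hA.eigenvalues i) (hB.eigenvalues j) t :=
    (integrable_taylorKernel _ _).const_mul _
  simp only [IsHermitian.koplienkoShift]
  rw [MeasureTheory.integral_finsetSum _ fun i _ =>
    MeasureTheory.integrable_finsetSum _ fun j _ => hint i j, ← hA.sum_overlap_mul_sq hB,
    Finset.mul_sum]
  refine Finset.sum_congr rfl fun i _ => ?_
  rw [MeasureTheory.integral_finsetSum _ fun j _ => hint i j, Finset.mul_sum]
  refine Finset.sum_congr rfl fun j _ => ?_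
  rw [MeasureTheory.integral_const_mul, integral_taylorKernel]
  ring

lemma IsHermitian.support_koplienkoShift_subset {A B : Matrix n n ℂ} (hA : A.IsHermitian)
    (hB : B.IsHermitian) {a b : ℝ} (ha : ∀ i, hA.eigenvalues i ∈ Set.Icc a b)
    (hb : ∀ i, hB.eigenvalues i ∈ Set.Icc a b) :
    Function.support (hA.koplienkoShift hB) ⊆ Set.Icc a b := by
  intro t ht
  obtain ⟨i, -, hi⟩ := Finset.exists_ne_zero_of_sum_ne_zero ht
  obtain ⟨j, -, hj⟩ := Finset.exists_ne_zero_of_sum_ne_zero hi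
  exact Set.ordConnected_Icc.uIcc_subset (hb j) (ha i)
    (support_taylorKernel_subset _ _ (right_ne_zero_of_mul hj))

lemma IsHermitian.integral_mul_koplienkoShift {A B : Matrix n n ℂ} (hA : A.IsHermitian)
    (hB : B.IsHermitian) {a b : ℝ} (ha : ∀ i, hA.eigenvalues i ∈ Set.Icc a b)
    (hb : ∀ i, hB.eigenvalues i ∈ Set.Icc a b) (p : Polynomial ℂ) :
    ∫ t in a..b, p.derivative.derivative.eval (t : ℂ) * (hA.koplienkoShift hB t : ℂ) =
      (Polynomial.aeval A p - Polynomial.aeval B p -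
        Polynomial.aeval B p.derivative * (A - B)).trace := by
  have hint (i j : n) : IntervalIntegrable (fun t : ℝ => (hA.overlap hB i j : ℂ) *
      (p.derivative.derivative.eval (t : ℂ) *
        (taylorKernel (hA.eigenvalues i) (hB.eigenvalues j) t : ℂ)))
      MeasureTheory.volume a b :=
    ((integrable_taylorKernel _ _).ofReal.intervalIntegrable.continuousOn_mul
      (by fun_prop)).const_mul _
  have hsum (t : ℝ) : p.derivative.derivative.eval (t : ℂ) * (hA.koplienkoShift hB t : ℂ) =
      ∑ i, ∑ j, (hA.overlap hB i j : ℂ) * (p.derivative.derivative.eval (t : ℂ) *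
        (taylorKernel (hA.eigenvalues i) (hB.eigenvalues j) t : ℂ)) := by
    simp only [IsHermitian.koplienkoShift, Complex.ofReal_sum, Complex.ofReal_mul,
      Finset.mul_sum, mul_left_comm]
  simp only [hsum]
  rw [hA.trace_taylor_remainder hB, intervalIntegral.integral_finsetSum fun i _ => by
    simpa only [Finset.sum_fn] using IntervalIntegrable.sum Finset.univ fun j _ => hint i j]
  refine Finset.sum_congr rfl fun i _ => ?_
  rw [intervalIntegral.integral_finsetSum fun j _ => hint i j]
  refine Finset.sum_congr rfl fun j _ => ?_
  rw [intervalIntegral.integral_const_mul,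
    integral_derivative_derivative_mul_taylorKernel (ha i) (hb j)]

end Matrix


/-- Finite-dimensional Koplienko trace formula: for Hermitian matrices
`H₀, H` with `V = H − H₀`, there is a non-negative integrable `η` supported in a compact
interval `[a,b]` with `∫ η = ½‖V‖₂²` such that for every complex polynomial `p`,
`Tr(p(H) − p(H₀) − Dp(H₀)·V) = ∫_a^b p''(λ) η(λ) dλ`, where
`Dp(H₀)·V = ∑_r c_r ∑_{j<r} H₀^{r−j−1} V H₀^j` for `p = ∑_r c_r λ^r`. -/
theorem stmt_7 {n : ℕ} (H H₀ V : Matrix (Fin n) (Fin n) ℂ)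
    (hH : H.IsHermitian) (hH₀ : H₀.IsHermitian) (hV : V = H - H₀) :
    ∃ (a b : ℝ) (η : ℝ → ℝ), a ≤ b ∧ (∀ lam : ℝ, 0 ≤ η lam) ∧
      MeasureTheory.Integrable η ∧ Function.support η ⊆ Set.Icc a b ∧
      (∫ lam : ℝ, η lam) = (1 / 2) * ((Vᴴ * V).trace).re ∧
      ∀ p : Polynomial ℂ,
        (Polynomial.aeval H p - Polynomial.aeval H₀ p -
            ∑ r ∈ p.support, p.coeff r •
              ∑ j ∈ Finset.range r, H₀ ^ (r - j - 1) * V * H₀ ^ j).trace =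
          ∫ lam in a..b,
            Polynomial.eval (lam : ℂ) (Polynomial.derivative (Polynomial.derivative p)) *
              (η lam : ℂ) := by
  subst hV
  set M := ∑ i, |hH.eigenvalues i| + ∑ i, |hH₀.eigenvalues i|
  have h1 : 0 ≤ ∑ i, |hH.eigenvalues i| := Finset.sum_nonneg fun _ _ => abs_nonneg _
  have h0 : 0 ≤ ∑ i, |hH₀.eigenvalues i| := Finset.sum_nonneg fun _ _ => abs_nonneg _
  have ha (i : Fin n) : hH.eigenvalues i ∈ Set.Icc (-M) M := by
    have := Finset.single_le_sum (fun j _ => abs_nonneg (hH.eigenvalues j)) (Finset.mem_univ i)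
    exact abs_le.1 (by linarith)
  have hb (i : Fin n) : hH₀.eigenvalues i ∈ Set.Icc (-M) M := by
    have := Finset.single_le_sum (fun j _ => abs_nonneg (hH₀.eigenvalues j)) (Finset.mem_univ i)
    exact abs_le.1 (by linarith)
  refine ⟨-M, M, hH.koplienkoShift hH₀, by linarith, hH.koplienkoShift_nonneg hH₀,
    hH.integrable_koplienkoShift hH₀, hH.support_koplienkoShift_subset hH₀ ha hb,
    hH.integral_koplienkoShift hH₀, fun p => ?_⟩
  rw [hH.integral_mul_koplienkoShift hH₀ ha hb, Matrix.trace_sub,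
    Matrix.trace_sum_pow_mul_mul_pow, ← Matrix.trace_sub]
end

section
/- Let H, H₀ be bounded self-adjoint operators on a separable infinite-dimensional Hilbert space with V = H − H₀ ∈ B₂(H). Then p(H) − p(H₀) − Dp(H₀)·V is trace class for every polynomial p, and there exists a unique non-negative η ∈ L¹([a,b]) with a = inf σ(H₀) − ‖V‖, b = sup σ(H₀) + ‖V‖, such that Tr(p(H) − p(H₀) − Dp(H₀)·V) = ∫_a^b p''(λ)η(λ)dλ for all polynomials p, and ∫_a^b η(λ)dλ = ½‖V‖₂² (Koplienko trace formula, bounded case). -/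
/-- `T` is Hilbert–Schmidt (w.r.t. the Hilbert basis `bas`). -/
def IsHS {𝓗 : Type*} [NormedAddCommGroup 𝓗] [InnerProductSpace ℂ 𝓗] [CompleteSpace 𝓗]
    {ι : Type*} (bas : HilbertBasis ι ℂ 𝓗) (T : 𝓗 →L[ℂ] 𝓗) : Prop :=
  Summable fun i => ‖T (bas i)‖ ^ 2

/-- The Hilbert–Schmidt norm of `T` (w.r.t. the Hilbert basis `bas`). -/
noncomputable def hsNorm {𝓗 : Type*} [NormedAddCommGroup 𝓗] [InnerProductSpace ℂ 𝓗]
    [CompleteSpace 𝓗] {ι : Type*} (bas : HilbertBasis ι ℂ 𝓗) (T : 𝓗 →L[ℂ] 𝓗) : ℝ :=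
  Real.sqrt (∑' i, ‖T (bas i)‖ ^ 2)

/-- `T` is trace class: it factors as a product of two Hilbert–Schmidt operators. -/
def IsTC {𝓗 : Type*} [NormedAddCommGroup 𝓗] [InnerProductSpace ℂ 𝓗] [CompleteSpace 𝓗]
    {ι : Type*} (bas : HilbertBasis ι ℂ 𝓗) (T : 𝓗 →L[ℂ] 𝓗) : Prop :=
  ∃ A B : 𝓗 →L[ℂ] 𝓗, T = A * B ∧ IsHS bas A ∧ IsHS bas B

/-- The trace of `T` computed along the Hilbert basis `bas`. -/
noncomputable def traceAlong {𝓗 : Type*} [NormedAddCommGroup 𝓗] [InnerProductSpace ℂ 𝓗]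
    [CompleteSpace 𝓗] {ι : Type*} (bas : HilbertBasis ι ℂ 𝓗) (T : 𝓗 →L[ℂ] 𝓗) : ℂ :=
  ∑' i, @inner ℂ _ _ (bas i) (T (bas i))

/-- The Fréchet derivative of a polynomial `p` at `H₀` applied to `V`. -/
noncomputable def polyDeriv {𝓗 : Type*} [NormedAddCommGroup 𝓗] [InnerProductSpace ℂ 𝓗]
    [CompleteSpace 𝓗] (p : Polynomial ℂ) (H₀ V : 𝓗 →L[ℂ] 𝓗) : 𝓗 →L[ℂ] 𝓗 :=
  ∑ r ∈ p.support, p.coeff r • ∑ j ∈ Finset.range r, H₀ ^ (r - j - 1) * V * H₀ ^ j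

open MeasureTheory
open scoped InnerProductSpace

theorem IsStarNormal.exists_spectral_measure {K : Type*} [NormedAddCommGroup K]
    [InnerProductSpace ℂ K] [CompleteSpace K] {N : K →L[ℂ] K} (hN : IsStarNormal N) (v : K) :
    ∃ μ : Measure (spectrum ℂ N), IsFiniteMeasure μ ∧ ∀ f : C(spectrum ℂ N, ℝ),
      ((∫ z, f z ∂μ : ℝ) : ℂ) =
        ⟪v, cfcHom hN ((⟨Complex.ofReal, Complex.continuous_ofReal⟩ : C(ℝ, ℂ)).comp f) v⟫_ℂ := by
  set J : C(ℝ, ℂ) := ⟨Complex.ofReal, Complex.continuous_ofReal⟩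
  have hsa (f : C(spectrum ℂ N, ℝ)) : IsSelfAdjoint (cfcHom hN (J.comp f)) := by
    rw [IsSelfAdjoint, ← map_star]
    congr 1
    ext z
    simp [J]
  have hmul (f g : C(spectrum ℂ N, ℝ)) :
      cfcHom hN (J.comp (f * g)) = cfcHom hN (J.comp f) * cfcHom hN (J.comp g) := by
    rw [← map_mul]
    congr 1
    ext z
    simp [J]
  have hadd (f g : C(spectrum ℂ N, ℝ)) :
      cfcHom hN (J.comp (f + g)) = cfcHom hN (J.comp f) + cfcHom hN (J.comp g) := by
    rw [← map_add]
    congr 1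
    ext z
    simp [J]
  have hsmul (c : ℝ) (f : C(spectrum ℂ N, ℝ)) :
      cfcHom hN (J.comp (c • f)) = (c : ℂ) • cfcHom hN (J.comp f) := by
    rw [← map_smul]
    congr 1
    ext z
    simp [J]
  have hsymm (f : C(spectrum ℂ N, ℝ)) (x y : K) :
      ⟪cfcHom hN (J.comp f) x, y⟫_ℂ = ⟪x, cfcHom hN (J.comp f) y⟫_ℂ :=
    (hsa f).isSymmetric x y
  let Λ : C(spectrum ℂ N, ℝ) →ₗ[ℝ] ℝ :=
    { toFun f := (⟪v, cfcHom hN (J.comp f) v⟫_ℂ).re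
      map_add' f g := by rw [hadd]; simp
      map_smul' c f := by rw [hsmul]; simp }
  have hΛ (f : C(spectrum ℂ N, ℝ)) :
      ((Λ f : ℝ) : ℂ) = ⟪v, cfcHom hN (J.comp f) v⟫_ℂ := by
    refine Complex.conj_eq_iff_re.1 ?_
    rw [inner_conj_symm, hsymm]
  have hpos (f : C(spectrum ℂ N, ℝ)) (hf : 0 ≤ f) : 0 ≤ Λ f := by
    have hsq : f = (⟨fun z ↦ √(f z), by fun_prop⟩ : C(spectrum ℂ N, ℝ)) *
        ⟨fun z ↦ √(f z), by fun_prop⟩ := by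
      ext z
      exact (Real.mul_self_sqrt (hf z)).symm
    change 0 ≤ (⟪v, cfcHom hN (J.comp f) v⟫_ℂ).re
    rw [hsq, hmul, mul_apply_eq_comp, ← hsymm]
    exact inner_self_nonneg (𝕜 := ℂ)
  let E := CompactlySupportedContinuousMap.continuousMapEquiv (α := spectrum ℂ N) (β := ℝ)
  let Λ' : CompactlySupportedContinuousMap (spectrum ℂ N) ℝ →ₚ[ℝ] ℝ :=
    PositiveLinearMap.mk₀
      { toFun f := Λ (E.symm f)
        map_add' f g := Λ.map_add (E.symm f) (E.symm g)
        map_smul' c f := Λ.map_smul c (E.symm f) }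
      fun f hf ↦ hpos (E.symm f) fun z ↦ hf z
  refine ⟨RealRMK.rieszMeasure Λ', inferInstance, fun f ↦ ?_⟩
  rw [← hΛ]
  congr 1
  exact RealRMK.integral_rieszMeasure Λ' (E f)

set_option maxHeartbeats 1000000 in
theorem exists_joint_spectral_measure {K : Type*} [NormedAddCommGroup K]
    [InnerProductSpace ℂ K] [CompleteSpace K] {L R : K →L[ℂ] K} (hL : IsSelfAdjoint L)
    (hR : IsSelfAdjoint R) (hLR : Commute L R) {v : K} (hv : v ∈ closure (Set.range (L - R)))
    {a b : ℝ} (hLs : spectrum ℝ L ⊆ Set.Icc a b) (hRs : spectrum ℝ R ⊆ Set.Icc a b) :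
    ∃ ν : Measure (ℝ × ℝ), IsFiniteMeasure ν ∧
      (∀ᵐ z ∂ν, z.1 ∈ Set.Icc a b ∧ z.2 ∈ Set.Icc a b ∧ z.1 ≠ z.2) ∧
      ∀ c m : ℕ, ((∫ z, z.1 ^ c * z.2 ^ m ∂ν : ℝ) : ℂ) = ⟪v, (L ^ c * R ^ m) v⟫_ℂ := by
  set N : K →L[ℂ] K := L + Complex.I • R with hNdef
  have hstarN : star N = L - Complex.I • R := by
    rw [hNdef, star_add, star_smul, hL.star_eq, hR.star_eq]
    simp [sub_eq_add_neg]
  have hN : IsStarNormal N := by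
    refine ⟨?_⟩
    rw [hstarN, hNdef, Commute, SemiconjBy]
    simp only [sub_mul, mul_add, add_mul, mul_sub, smul_mul_assoc, mul_smul_comm, hLR.eq,
      smul_add, smul_sub]
    abel
  set J : C(ℝ, ℂ) := ⟨Complex.ofReal, Complex.continuous_ofReal⟩ with hJ
  set X : C(spectrum ℂ N, ℝ) := ⟨fun z ↦ z.1.re, by fun_prop⟩ with hX
  set Y : C(spectrum ℂ N, ℝ) := ⟨fun z ↦ z.1.im, by fun_prop⟩ with hY
  have hid : cfcHom hN (.restrict (spectrum ℂ N) (.id ℂ)) = N := cfcHom_id hN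
  have hXL : cfcHom hN (J.comp X) = L := by
    have : J.comp X = (2⁻¹ : ℂ) • ((ContinuousMap.restrict (spectrum ℂ N) (.id ℂ)) +
        star (ContinuousMap.restrict (spectrum ℂ N) (.id ℂ))) := by
      ext z
      simp [J, X, Complex.add_conj]
    rw [this, map_smul, map_add, map_star, hid, hstarN, hNdef, add_add_sub_cancel, ← two_smul ℂ,
      smul_smul]
    simp
  have hYR : cfcHom hN (J.comp Y) = R := by
    have : J.comp Y = (2 * Complex.I)⁻¹ • ((ContinuousMap.restrict (spectrum ℂ N) (.id ℂ)) -
        star (ContinuousMap.restrict (spectrum ℂ N) (.id ℂ))) := by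
      ext z
      simp only [J, Y, ContinuousMap.comp_apply, ContinuousMap.coe_mk, ContinuousMap.smul_apply,
        ContinuousMap.sub_apply, ContinuousMap.star_apply, ContinuousMap.restrict_apply,
        ContinuousMap.id_apply, smul_eq_mul]
      erw [Complex.sub_conj]
      field_simp
      push_cast
      ring
    rw [this, map_smul, map_sub, map_star, hid, hstarN, hNdef, add_sub_sub_cancel, ← two_smul ℂ,
      smul_smul, smul_smul, mul_assoc, inv_mul_cancel₀ (by simp), one_smul]
  have hspec {A : K →L[ℂ] K} {f : C(spectrum ℂ N, ℝ)} (hA : cfcHom hN (J.comp f) = A)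
      (hAs : spectrum ℝ A ⊆ Set.Icc a b) (z : spectrum ℂ N) : f z ∈ Set.Icc a b := by
    refine hAs ((spectrum.algebraMap_mem_iff ℂ).1 ?_)
    rw [← hA, cfcHom_map_spectrum]
    exact ⟨z, rfl⟩
  obtain ⟨μ, hμ, hint⟩ := hN.exists_spectral_measure v
  have hnorm (g : C(spectrum ℂ N, ℂ)) : ‖cfcHom hN g‖ = ‖g‖ := norm_cfcHom N g hN
  have hdiag : μ {z | z.1.re = z.1.im} = 0 := by
    have hclosed : IsClosed {z : spectrum ℂ N | z.1.re = z.1.im} :=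
      isClosed_eq (by fun_prop) (by fun_prop)
    have hbound (δ : ℝ) (hδ : 0 < δ) (w : K) :
        μ.real {z | z.1.re = z.1.im} ≤ ‖v‖ * (δ * ‖w‖ + ‖v - (L - R) w‖) := by
      have hden (z : spectrum ℂ N) : 0 < δ ^ 2 + (z.1.re - z.1.im) ^ 2 := by positivity
      set f : C(spectrum ℂ N, ℝ) :=
        ⟨fun z ↦ δ ^ 2 / (δ ^ 2 + (z.1.re - z.1.im) ^ 2),
          .div (by fun_prop) (by fun_prop) fun z ↦ (hden z).ne'⟩ with hf
      have hf0 (z : spectrum ℂ N) : 0 ≤ f z := by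
        simp only [hf, ContinuousMap.coe_mk]; positivity
      have hfi : Integrable f μ := f.continuous.integrable_of_hasCompactSupport
        (HasCompactSupport.of_compactSpace f)
      have h1 : μ.real {z | z.1.re = z.1.im} ≤ ∫ z, f z ∂μ := by
        calc μ.real {z | z.1.re = z.1.im} = ∫ z in {z | z.1.re = z.1.im}, f z ∂μ := by
              rw [setIntegral_congr_fun (g := fun _ ↦ (1 : ℝ)) hclosed.measurableSet]
              · simp
              · intro z hz
                have hz' : z.1.re - z.1.im = 0 := sub_eq_zero.2 hz
                simp [hf, hz', hδ.ne']
          _ ≤ ∫ z, f z ∂μ := setIntegral_le_integral hfi (.of_forall hf0)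
      set F := cfcHom hN (J.comp f) with hF
      have hFn : ‖F‖ ≤ 1 := by
        rw [hF, hnorm, ContinuousMap.norm_le _ zero_le_one]
        intro z
        have : f z ≤ 1 := by
          simp only [hf, ContinuousMap.coe_mk]
          rw [div_le_one (hden z)]
          nlinarith [sq_nonneg (z.1.re - z.1.im)]
        simpa [J, abs_of_nonneg (hf0 z)] using this
      have hFn' : ‖F * (L - R)‖ ≤ δ := by
        rw [hF, ← hXL, ← hYR, ← map_sub, ← map_mul, hnorm, ContinuousMap.norm_le _ hδ.le]
        intro z
        have : |f z * (X z - Y z)| ≤ δ := by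
          simp only [hf, hX, hY, ContinuousMap.coe_mk]
          rw [div_mul_eq_mul_div, abs_div, abs_of_pos (hden z), div_le_iff₀ (hden z), abs_mul,
            abs_of_pos (by positivity : 0 < δ ^ 2)]
          nlinarith [sq_nonneg (δ - |z.1.re - z.1.im|), sq_abs (z.1.re - z.1.im),
            abs_nonneg (z.1.re - z.1.im), mul_nonneg hδ.le (abs_nonneg (z.1.re - z.1.im)),
            mul_nonneg hδ.le (sq_nonneg (δ - |z.1.re - z.1.im|))]
        simpa [J, ← Complex.ofReal_sub, -Complex.norm_mul, ← Complex.ofReal_mul] using this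
      have h2 : ‖F v‖ ≤ δ * ‖w‖ + ‖v - (L - R) w‖ := by
        have : F v = (F * (L - R)) w + F (v - (L - R) w) := by
          simp [map_sub, mul_apply_eq_comp]
        rw [this]
        refine (norm_add_le _ _).trans (add_le_add ?_ ?_)
        · exact (F * (L - R)).le_of_opNorm_le hFn' w
        · simpa using F.le_of_opNorm_le hFn (v - (L - R) w)
      calc μ.real {z | z.1.re = z.1.im} ≤ ∫ z, f z ∂μ := h1
        _ ≤ ‖((∫ z, f z ∂μ : ℝ) : ℂ)‖ := by simpa using le_abs_self _
        _ = ‖⟪v, F v⟫_ℂ‖ := by rw [hint]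
        _ ≤ ‖v‖ * ‖F v‖ := norm_inner_le_norm _ _
        _ ≤ _ := by gcongr
    have hle (ε : ℝ) (hε : 0 < ε) : μ.real {z | z.1.re = z.1.im} ≤ ‖v‖ * ε := by
      obtain ⟨_, ⟨w, rfl⟩, hw⟩ := Metric.mem_closure_iff.1 hv (ε / 2) (by positivity)
      refine (hbound (ε / (2 * (‖w‖ + 1))) (by positivity) w).trans ?_
      gcongr
      rw [dist_eq_norm] at hw
      have : ε / (2 * (‖w‖ + 1)) * ‖w‖ ≤ ε / 2 := by
        rw [div_mul_eq_mul_div, div_le_iff₀ (by positivity)]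
        nlinarith [norm_nonneg w]
      linarith
    have h0 : μ.real {z | z.1.re = z.1.im} ≤ 0 := by
      refine le_of_forall_pos_le_add fun ε hε ↦ ?_
      refine (hle (ε / (‖v‖ + 1)) (by positivity)).trans ?_
      rw [zero_add, mul_div_assoc', div_le_iff₀ (by positivity)]
      nlinarith [norm_nonneg v]
    exact (measureReal_eq_zero_iff).1 (le_antisymm h0 measureReal_nonneg)
  have hXY : Measurable fun z : spectrum ℂ N ↦ (z.1.re, z.1.im) := by fun_prop
  refine ⟨μ.map fun z ↦ (z.1.re, z.1.im), inferInstance, ?_, fun c m ↦ ?_⟩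
  · rw [ae_map_iff hXY.aemeasurable (by measurability)]
    have : ∀ᵐ z ∂μ, z.1.re ≠ z.1.im := by simpa [ae_iff] using hdiag
    filter_upwards [this] with z hz
    exact ⟨hspec hXL hLs z, hspec hYR hRs z, hz⟩
  · rw [integral_map hXY.aemeasurable (by fun_prop)]
    have := hint (X ^ c * Y ^ m)
    have h2 : J.comp (X ^ c * Y ^ m) = J.comp X ^ c * J.comp Y ^ m := by
      ext z
      simp [J]
    rw [← hJ, h2, map_mul, map_pow, map_pow, hXL, hYR] at this
    exact this

theorem exists_density_of_segment_average {a b : ℝ} (ν : Measure (ℝ × ℝ)) [IsFiniteMeasure ν]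
    (hν : ∀ᵐ z ∂ν, z.1 ∈ Set.Icc a b ∧ z.2 ∈ Set.Icc a b ∧ z.1 ≠ z.2) :
    ∃ η : ℝ → ℝ, (∀ x, 0 ≤ η x) ∧ Function.support η ⊆ Set.Icc a b ∧
      IntegrableOn η (Set.Icc a b) ∧
      ∀ f : ℝ → ℂ, Continuous f → ∫ x in Set.Icc a b, f x * η x =
        ∫ z, (∫ t in (0 : ℝ)..1, (1 - t) * f (z.2 + t * (z.1 - z.2))) ∂ν := by
  set τ : Measure ℝ := (volume.restrict (Set.Icc 0 1)).withDensity fun t ↦ ENNReal.ofReal (1 - t)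
    with hτ
  have hτv : τ ≪ volume.restrict (Set.Icc 0 1) := withDensity_absolutelyContinuous _ _
  have hτ01 : ∀ᵐ t ∂τ, t ∈ Set.Icc (0 : ℝ) 1 := hτv.ae_le (ae_restrict_mem measurableSet_Icc)
  have : IsFiniteMeasure τ :=
    isFiniteMeasure_withDensity_ofReal
      (Continuous.integrableOn_Icc (by fun_prop : Continuous fun t : ℝ ↦ 1 - t)).2
  set Φ : (ℝ × ℝ) × ℝ → ℝ := fun p ↦ p.1.2 + p.2 * (p.1.1 - p.1.2) with hΦ
  have hΦc : Continuous Φ := by fun_prop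
  set μ := (ν.prod τ).map Φ with hμ
  have hac : μ ≪ volume := by
    refine Measure.AbsolutelyContinuous.mk fun E hE hE0 ↦ ?_
    rw [hμ, Measure.map_apply hΦc.measurable hE,
      Measure.measure_prod_null (hΦc.measurable hE)]
    filter_upwards [hν] with z hz
    refine hτv (Measure.absolutelyContinuous_of_le Measure.restrict_le_self ?_)
    have : Prod.mk z ⁻¹' (Φ ⁻¹' E) = (· * (z.1 - z.2)) ⁻¹' ((z.2 + ·) ⁻¹' E) := rfl
    rw [this, Real.volume_preimage_mul_right (sub_ne_zero.2 hz.2.2), measure_preimage_add, hE0,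
      mul_zero]
  have hmem : ∀ᵐ x ∂μ, x ∈ Set.Icc a b := by
    refine (ae_map_iff (p := (· ∈ Set.Icc a b)) hΦc.aemeasurable measurableSet_Icc).2 ?_
    refine Measure.ae_prod_iff_ae_ae (hΦc.measurable measurableSet_Icc) |>.2 ?_
    filter_upwards [hν] with z hz
    filter_upwards [hτ01] with t ht
    have := (convex_Icc a b).lineMap_mem hz.2.1 hz.1 ht
    simpa [hΦ, AffineMap.lineMap_apply, add_comm] using this
  have hres : μ.restrict (Set.Icc a b) = μ := Measure.restrict_eq_self_of_ae_mem hmem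
  refine ⟨(Set.Icc a b).indicator fun x ↦ (μ.rnDeriv volume x).toReal,
    fun x ↦ Set.indicator_nonneg (fun _ _ ↦ ENNReal.toReal_nonneg) x,
    Set.support_indicator_subset,
    (Measure.integrable_toReal_rnDeriv.indicator measurableSet_Icc).integrableOn, fun f hf ↦ ?_⟩
  have hfi : Integrable f μ := by
    rw [← hres]
    exact hf.continuousOn.integrableOn_compact isCompact_Icc
  calc _ = ∫ x in Set.Icc a b, (μ.rnDeriv volume x).toReal • f x := by
        refine setIntegral_congr_fun measurableSet_Icc fun x hx ↦ ?_
        simp [hx, mul_comm]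
    _ = ∫ x in Set.Icc a b, f x ∂μ := setIntegral_rnDeriv_smul hac measurableSet_Icc
    _ = ∫ p, f (Φ p) ∂(ν.prod τ) := by
        rw [hres, hμ, integral_map hΦc.aemeasurable hf.aestronglyMeasurable]
    _ = ∫ z, ∫ t, f (Φ (z, t)) ∂τ ∂ν := 
        integral_prod _ ((integrable_map_measure hf.aestronglyMeasurable hΦc.aemeasurable).1 hfi)
    _ = _ := by
        congr 1
        ext z
        rw [hτ, integral_withDensity_eq_integral_toReal_smul (by fun_prop) (by simp),
          intervalIntegral.integral_of_le zero_le_one, ← integral_Icc_eq_integral_Ioc]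
        refine setIntegral_congr_fun measurableSet_Icc fun t ht ↦ ?_
        simp [ENNReal.toReal_ofReal (sub_nonneg.2 ht.2), hΦ]

open Polynomial in
theorem integral_one_sub_mul_derivative_derivative (p : ℂ[X]) (x y : ℝ) :
    (x - y : ℂ) ^ 2 * ∫ t in (0 : ℝ)..1,
        ((1 - t) * (derivative (derivative p)).eval ((y + t * (x - y) : ℝ) : ℂ)) =
      p.eval (x : ℂ) - p.eval (y : ℂ) - (derivative p).eval (y : ℂ) * (x - y) := by
  have hd (q : ℂ[X]) (t : ℝ) : HasDerivAt (fun t : ℝ ↦ q.eval ((y + t * (x - y) : ℝ) : ℂ))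
      ((derivative q).eval ((y + t * (x - y) : ℝ) : ℂ) * (x - y)) t := by
    have h1 : HasDerivAt (fun t : ℝ ↦ ((y + t * (x - y) : ℝ) : ℂ)) ((x - y : ℝ) : ℂ) t := by
      refine HasDerivAt.ofReal_comp ?_
      simpa using ((hasDerivAt_id t).mul_const (x - y)).const_add y
    have := (q.hasDerivAt _).comp t h1
    simpa [Function.comp_def] using this
  have hG (t : ℝ) : HasDerivAt
      (fun t : ℝ ↦ (1 - t : ℂ) * ((derivative p).eval ((y + t * (x - y) : ℝ) : ℂ) * (x - y)) +
        p.eval ((y + t * (x - y) : ℝ) : ℂ))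
      ((x - y : ℂ) ^ 2 *
        ((1 - t) * (derivative (derivative p)).eval ((y + t * (x - y) : ℝ) : ℂ))) t := by
    have h1 : HasDerivAt (fun t : ℝ ↦ (1 - t : ℂ)) (-1) t := by
      simpa using ((hasDerivAt_id t).ofReal_comp).const_sub (1 : ℂ)
    refine ((h1.mul ((hd (derivative p) t).mul_const (x - y : ℂ))).add (hd p t)).congr_deriv ?_
    ring
  rw [← intervalIntegral.integral_const_mul,
    intervalIntegral.integral_eq_sub_of_hasDerivAt (fun t _ ↦ hG t)
      (Continuous.intervalIntegrable (by fun_prop) _ _)]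
  simp
  ring

/-- Integrable functions on a bounded interval with the same polynomial moments agree a.e. -/
theorem ae_eq_of_forall_integral_polynomial_eq {a b : ℝ} {f g : ℝ → ℝ}
    (hf : IntegrableOn f (Set.Icc a b)) (hg : IntegrableOn g (Set.Icc a b))
    (h : ∀ q : Polynomial ℝ, ∫ x in Set.Icc a b, q.eval x * f x =
      ∫ x in Set.Icc a b, q.eval x * g x) :
    f =ᵐ[volume.restrict (Set.Icc a b)] g := by
  have hfg := hf.sub hg
  have hmom (q : Polynomial ℝ) : ∫ x in Set.Icc a b, q.eval x * (f - g) x = 0 := by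
    have hq {u : ℝ → ℝ} (hu : IntegrableOn u (Set.Icc a b)) :
        IntegrableOn (fun x ↦ q.eval x * u x) (Set.Icc a b) :=
      hu.continuousOn_mul q.continuous.continuousOn isCompact_Icc
    simp only [Pi.sub_apply, mul_sub]
    rw [integral_sub (hq hf) (hq hg), h, sub_self]
  suffices h0 : ∀ᵐ x ∂volume.restrict (Set.Icc a b), (f - g) x = 0 by
    filter_upwards [h0] with x hx using sub_eq_zero.1 hx
  refine ae_eq_zero_of_integral_contDiff_smul_eq_zero hfg.locallyIntegrable fun φ hφ _ ↦ ?_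
  rw [← norm_le_zero_iff]
  refine le_of_forall_pos_le_add fun ε hε ↦ ?_
  set M := ∫ x in Set.Icc a b, ‖(f - g) x‖
  have hM : 0 ≤ M := integral_nonneg fun _ ↦ norm_nonneg _
  obtain ⟨q, hq⟩ := exists_polynomial_near_of_continuousOn a b φ hφ.continuous.continuousOn
    (ε / (M + 1)) (by positivity)
  have hint {u : ℝ → ℝ} (hu : Continuous u) :
      IntegrableOn (fun x ↦ u x * (f - g) x) (Set.Icc a b) :=
    IntegrableOn.continuousOn_mul hu.continuousOn hfg isCompact_Icc
  calc ‖∫ x in Set.Icc a b, φ x • (f - g) x‖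
      = ‖∫ x in Set.Icc a b, (φ x - q.eval x) * (f - g) x‖ := by
        simp only [smul_eq_mul, sub_mul]
        rw [integral_sub (hint hφ.continuous) (hint q.continuous), hmom, sub_zero]
    _ ≤ ∫ x in Set.Icc a b, ε / (M + 1) * ‖(f - g) x‖ := by
        refine norm_integral_le_of_norm_le (hfg.norm.const_mul _) ?_
        filter_upwards [ae_restrict_mem measurableSet_Icc] with x hx
        rw [norm_mul, norm_sub_rev]
        gcongr
        exact (hq x hx).le
    _ = ε / (M + 1) * M := integral_const_mul _ _
    _ ≤ 0 + ε := by
        rw [div_mul_eq_mul_div, div_le_iff₀ (by positivity)]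
        nlinarith

theorem pow_sub_pow_eq_sum_pow_mul_sub_mul_pow {A : Type*} [Ring A] (x y : A) (n : ℕ) :
    x ^ n - y ^ n = ∑ j ∈ Finset.range n, x ^ j * (x - y) * y ^ (n - j - 1) := by
  induction n with
  | zero => simp
  | succ n ih =>
    have h : ∑ j ∈ Finset.range n, x ^ j * (x - y) * y ^ (n + 1 - j - 1) = (x ^ n - y ^ n) * y := by
      rw [ih, Finset.sum_mul]
      refine Finset.sum_congr rfl fun j hj ↦ ?_
      rw [show n + 1 - j - 1 = n - j - 1 + 1 by grind, pow_succ]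
      simp only [mul_assoc]
    rw [Finset.sum_range_succ, h]
    simp [pow_succ]
    noncomm_ring

theorem pow_sub_pow_eq_sum_pow_mul_sub_mul_pow' {A : Type*} [Ring A] (x y : A) (n : ℕ) :
    x ^ n - y ^ n = ∑ j ∈ Finset.range n, y ^ (n - j - 1) * (x - y) * x ^ j := by
  induction n with
  | zero => simp
  | succ n ih =>
    have h : ∑ j ∈ Finset.range n, y ^ (n + 1 - j - 1) * (x - y) * x ^ j = y * (x ^ n - y ^ n) := by
      rw [ih, Finset.mul_sum]
      refine Finset.sum_congr rfl fun j hj ↦ ?_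
      rw [show n + 1 - j - 1 = n - j - 1 + 1 by grind, pow_succ']
      simp only [mul_assoc]
    rw [Finset.sum_range_succ, h]
    simp [pow_succ']
    noncomm_ring

theorem pow_sub_pow_sub_sum_eq {A : Type*} [Ring A] (x y : A) (n : ℕ) :
    x ^ n - y ^ n - ∑ j ∈ Finset.range n, y ^ (n - j - 1) * (x - y) * y ^ j =
      ∑ j ∈ Finset.range n, ∑ c ∈ Finset.range j,
        y ^ (n - j - 1) * (x - y) * (x ^ c * (x - y) * y ^ (j - c - 1)) := by
  rw [pow_sub_pow_eq_sum_pow_mul_sub_mul_pow', ← Finset.sum_sub_distrib]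
  refine Finset.sum_congr rfl fun j _ ↦ ?_
  rw [← mul_sub, pow_sub_pow_eq_sum_pow_mul_sub_mul_pow, Finset.mul_sum]

/-- Second order Taylor formula for polynomials in noncommuting variables. -/
theorem aeval_sub_aeval_sub_sum_eq {A : Type*} [Ring A] [Algebra ℂ A] (p : Polynomial ℂ) (x y : A) :
    Polynomial.aeval x p - Polynomial.aeval y p - ∑ r ∈ p.support, p.coeff r •
        ∑ j ∈ Finset.range r, y ^ (r - j - 1) * (x - y) * y ^ j =
      ∑ r ∈ p.support, p.coeff r • ∑ j ∈ Finset.range r, ∑ c ∈ Finset.range j,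
        y ^ (r - j - 1) * (x - y) * (x ^ c * (x - y) * y ^ (j - c - 1)) := by
  have h (z : A) : Polynomial.aeval z p = ∑ r ∈ p.support, p.coeff r • z ^ r := by
    rw [Polynomial.aeval_def, Polynomial.eval₂_eq_sum, Polynomial.sum_def]
    simp only [Algebra.smul_def]
  rw [h, h, ← Finset.sum_sub_distrib, ← Finset.sum_sub_distrib]
  simp only [← smul_sub, pow_sub_pow_sub_sum_eq]

theorem sub_sq_mul_sum_eq (p : Polynomial ℂ) (x y : ℂ) :
    (x - y) ^ 2 * ∑ r ∈ p.support, p.coeff r * ∑ j ∈ Finset.range r, ∑ c ∈ Finset.range j,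
        x ^ c * y ^ (r - j - 1 + (j - c - 1)) =
      p.eval x - p.eval y - p.derivative.eval y * (x - y) := by
  have h1 : p.derivative.eval y * (x - y) = ∑ r ∈ p.support, p.coeff r •
      ∑ j ∈ Finset.range r, y ^ (r - j - 1) * (x - y) * y ^ j := by
    rw [Polynomial.derivative_eval, Polynomial.sum_def, Finset.sum_mul]
    refine Finset.sum_congr rfl fun r _ ↦ ?_
    rw [Finset.sum_congr rfl fun j hj ↦ show y ^ (r - j - 1) * (x - y) * y ^ j =
      y ^ (r - 1) * (x - y) by
        rw [mul_right_comm, ← pow_add, show r - j - 1 + j = r - 1 by grind]]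
    simp
    ring
  have h2 := aeval_sub_aeval_sub_sum_eq p x y
  rw [Polynomial.coe_aeval_eq_eval, Polynomial.coe_aeval_eq_eval] at h2
  rw [h1, h2, Finset.mul_sum]
  refine Finset.sum_congr rfl fun r _ ↦ ?_
  rw [smul_eq_mul, mul_left_comm]
  simp only [Finset.mul_sum]
  refine Finset.sum_congr rfl fun j _ ↦ Finset.sum_congr rfl fun c _ ↦ ?_
  ring

theorem HilbertBasis.hasSum_norm_inner_sq {𝓗 : Type*} [NormedAddCommGroup 𝓗] [InnerProductSpace ℂ 𝓗]
    {ι : Type*} (bas : HilbertBasis ι ℂ 𝓗) (x : 𝓗) :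
    HasSum (fun i ↦ ‖⟪bas i, x⟫_ℂ‖ ^ 2) (‖x‖ ^ 2) := by
  have h := (bas.hasSum_inner_mul_inner x x).mapL Complex.reCLM
  convert h using 1
  · ext i
    rw [← inner_conj_symm x (bas i), RCLike.conj_mul]
    simp [← Complex.ofReal_pow]
  · simp [inner_self_eq_norm_sq_to_K, ← Complex.ofReal_pow]

theorem HilbertBasis.ext_clm {𝓗 : Type*} [NormedAddCommGroup 𝓗] [InnerProductSpace ℂ 𝓗]
    {ι : Type*} (bas : HilbertBasis ι ℂ 𝓗) {A B : 𝓗 →L[ℂ] 𝓗}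
    (h : ∀ i, A (bas i) = B (bas i)) : A = B := by
  refine ContinuousLinearMap.ext_on
    (Submodule.dense_iff_topologicalClosure_eq_top.2 bas.dense_span) ?_
  rintro _ ⟨i, rfl⟩
  exact h i

section HilbertSchmidt

variable {𝓗 : Type*} [NormedAddCommGroup 𝓗] [InnerProductSpace ℂ 𝓗] [CompleteSpace 𝓗]
  {ι : Type*} {bas : HilbertBasis ι ℂ 𝓗}

theorem isHS_iff_memℓp {T : 𝓗 →L[ℂ] 𝓗} : IsHS bas T ↔ Memℓp (fun i ↦ T (bas i)) 2 := by
  rw [memℓp_gen_iff (by norm_num)]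
  simp [IsHS]

namespace IsHS

variable {A B T : 𝓗 →L[ℂ] 𝓗}

/-- The family of images of the basis vectors under a Hilbert–Schmidt operator, as an element of
the Hilbert space `ℓ²(ι, 𝓗)`. -/
noncomputable def toLp (hT : IsHS bas T) : lp (fun _ : ι ↦ 𝓗) 2 :=
  ⟨fun i ↦ T (bas i), isHS_iff_memℓp.1 hT⟩

@[simp] theorem toLp_apply (hT : IsHS bas T) (i : ι) : hT.toLp i = T (bas i) := rfl

theorem add (hA : IsHS bas A) (hB : IsHS bas B) : IsHS bas (A + B) :=
  isHS_iff_memℓp.2 ((isHS_iff_memℓp.1 hA).add (isHS_iff_memℓp.1 hB))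

theorem smul (c : ℂ) (hA : IsHS bas A) : IsHS bas (c • A) :=
  isHS_iff_memℓp.2 ((isHS_iff_memℓp.1 hA).const_smul c)

theorem const_mul (A : 𝓗 →L[ℂ] 𝓗) (hT : IsHS bas T) : IsHS bas (A * T) := by
  refine Summable.of_nonneg_of_le (fun i ↦ by positivity) (fun i ↦ ?_) (hT.mul_left (‖A‖ ^ 2))
  rw [← mul_pow]
  gcongr
  exact A.le_opNorm _

theorem summable_norm_inner_sq (hT : IsHS bas T) :
    Summable fun p : ι × ι ↦ ‖⟪bas p.2, T (bas p.1)⟫_ℂ‖ ^ 2 := by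
  rw [summable_prod_of_nonneg fun _ ↦ by positivity]
  have h (i : ι) : HasSum (fun j ↦ ‖⟪bas j, T (bas i)⟫_ℂ‖ ^ 2) (‖T (bas i)‖ ^ 2) :=
    bas.hasSum_norm_inner_sq _
  refine ⟨fun i ↦ (h i).summable, ?_⟩
  have h' : (fun i ↦ ∑' j, ‖⟪bas j, T (bas i)⟫_ℂ‖ ^ 2) = fun i ↦ ‖T (bas i)‖ ^ 2 :=
    funext fun i ↦ (h i).tsum_eq
  exact h' ▸ hT

theorem star (hT : IsHS bas T) : IsHS bas (Star.star T) := by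
  have h := hT.summable_norm_inner_sq.prod_symm.prod
  refine h.congr fun i ↦ ?_
  rw [← (bas.hasSum_norm_inner_sq (Star.star T (bas i))).tsum_eq]
  refine tsum_congr fun j ↦ ?_
  rw [ContinuousLinearMap.star_eq_adjoint, ContinuousLinearMap.adjoint_inner_right,
    norm_inner_symm]
  rfl

theorem mul_const (hT : IsHS bas T) (A : 𝓗 →L[ℂ] 𝓗) : IsHS bas (T * A) := by
  simpa using (hT.star.const_mul (Star.star A)).star

theorem inner_toLp_star (hA : IsHS bas A) (hB : IsHS bas B) :
    ⟪hB.star.toLp, hA.star.toLp⟫_ℂ = ⟪hA.toLp, hB.toLp⟫_ℂ := by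
  have hs : Summable fun p : ι × ι ↦
      ⟪A (bas p.1), bas p.2⟫_ℂ * ⟪bas p.2, B (bas p.1)⟫_ℂ := by
    refine Summable.of_norm_bounded (hA.summable_norm_inner_sq.add hB.summable_norm_inner_sq)
      fun p ↦ ?_
    rw [norm_mul, norm_inner_symm]
    nlinarith [sq_nonneg (‖⟪bas p.2, A (bas p.1)⟫_ℂ‖ - ‖⟪bas p.2, B (bas p.1)⟫_ℂ‖),
      sq_nonneg ‖⟪bas p.2, A (bas p.1)⟫_ℂ‖, sq_nonneg ‖⟪bas p.2, B (bas p.1)⟫_ℂ‖]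
  rw [lp.inner_eq_tsum, lp.inner_eq_tsum]
  have h1 (i : ι) : ⟪hA.toLp i, hB.toLp i⟫_ℂ =
      ∑' j, ⟪A (bas i), bas j⟫_ℂ * ⟪bas j, B (bas i)⟫_ℂ := (bas.tsum_inner_mul_inner _ _).symm
  have h2 (j : ι) : ⟪hB.star.toLp j, hA.star.toLp j⟫_ℂ =
      ∑' i, ⟪Star.star B (bas j), bas i⟫_ℂ * ⟪bas i, Star.star A (bas j)⟫_ℂ :=
    (bas.tsum_inner_mul_inner _ _).symm
  rw [tsum_congr h1, tsum_congr h2]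
  refine Eq.trans ?_ (Summable.tsum_comm
    (f := fun i j ↦ ⟪A (bas i), bas j⟫_ℂ * ⟪bas j, B (bas i)⟫_ℂ) hs)
  refine tsum_congr fun j ↦ tsum_congr fun i ↦ ?_
  rw [ContinuousLinearMap.star_eq_adjoint, ContinuousLinearMap.star_eq_adjoint,
    ContinuousLinearMap.adjoint_inner_left, ContinuousLinearMap.adjoint_inner_right, mul_comm]

theorem hasSum_trace_mul (hA : IsHS bas A) (hB : IsHS bas B) :
    HasSum (fun i ↦ ⟪bas i, (A * B) (bas i)⟫_ℂ) ⟪hA.star.toLp, hB.toLp⟫_ℂ := by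
  have h : (fun i ↦ ⟪bas i, (A * B) (bas i)⟫_ℂ) =
      fun i ↦ ⟪hA.star.toLp i, hB.toLp i⟫_ℂ := by
    ext i
    rw [toLp_apply, toLp_apply, ContinuousLinearMap.star_eq_adjoint,
      ContinuousLinearMap.adjoint_inner_left]
    rfl
  exact h ▸ lp.hasSum_inner hA.star.toLp hB.toLp

theorem hsNorm_sq (hT : IsHS bas T) : (hsNorm bas T : ℂ) ^ 2 = ⟪hT.toLp, hT.toLp⟫_ℂ := by
  rw [lp.inner_eq_tsum, hsNorm, ← Complex.ofReal_pow,
    Real.sq_sqrt (tsum_nonneg fun _ ↦ by positivity), Complex.ofReal_tsum]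
  refine tsum_congr fun i ↦ ?_
  rw [toLp_apply, inner_self_eq_norm_sq_to_K]
  simp

end IsHS

theorem exists_isHS_toLp_eq (X : lp (fun _ : ι ↦ 𝓗) 2) :
    ∃ (T : 𝓗 →L[ℂ] 𝓗) (hT : IsHS bas T), hT.toLp = X := by
  classical
  have hX : Summable fun i ↦ ‖X i‖ ^ 2 := by
    simpa using (memℓp_gen_iff (by norm_num)).1 (lp.memℓp X)
  have hmem (y : 𝓗) : Memℓp (fun i ↦ ⟪X i, y⟫_ℂ) 2 := by
    rw [memℓp_gen_iff (by norm_num)]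
    refine Summable.of_nonneg_of_le (fun i ↦ by positivity) (fun i ↦ ?_)
      (hX.mul_right (‖y‖ ^ 2))
    rw [← mul_pow]
    simpa using pow_le_pow_left₀ (norm_nonneg _) (norm_inner_le_norm (X i) y) 2
  let M : 𝓗 →L[ℂ] lp (fun _ : ι ↦ ℂ) 2 := LinearMap.mkContinuous
    { toFun y := (⟨fun i ↦ ⟪X i, y⟫_ℂ, hmem y⟩ : lp (fun _ : ι ↦ ℂ) 2)
      map_add' y z := by ext i; exact inner_add_right _ _ _
      map_smul' c y := by ext i; exact inner_smul_right _ _ _ } ‖X‖ fun y ↦ by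
      refine lp.norm_le_of_tsum_le (by norm_num) (by positivity) ?_
      rw [Real.mul_rpow (norm_nonneg _) (norm_nonneg _), lp.norm_rpow_eq_tsum (by norm_num),
        ← tsum_mul_right]
      refine Summable.tsum_le_tsum (fun i ↦ ?_) ((memℓp_gen_iff (by norm_num)).1 (hmem y)) ?_
      · rw [← Real.mul_rpow (norm_nonneg _) (norm_nonneg _)]
        exact Real.rpow_le_rpow (norm_nonneg _) (norm_inner_le_norm _ _) (by norm_num)
      · simpa using hX.mul_right (‖y‖ ^ 2)
  have hM (i : ι) : (M.adjoint ∘L bas.repr.toContinuousLinearEquiv.toContinuousLinearMap) (bas i)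
      = X i := by
    refine ext_inner_right ℂ fun y ↦ ?_
    simp only [ContinuousLinearMap.comp_apply]
    rw [ContinuousLinearMap.adjoint_inner_left]
    have : bas.repr.toContinuousLinearEquiv.toContinuousLinearMap (bas i) =
      lp.single 2 i (1 : ℂ) := bas.repr_self i
    rw [this, lp.inner_single_left]
    simp [M]
  refine ⟨M.adjoint ∘L bas.repr.toContinuousLinearEquiv.toContinuousLinearMap, ?_, ?_⟩
  · unfold IsHS
    simpa only [hM] using hX
  · ext i
    exact hM i

namespace IsHS

variable {A B T : 𝓗 →L[ℂ] 𝓗}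

theorem toLp_congr (hA : IsHS bas A) (hB : IsHS bas B) (h : A = B) : hA.toLp = hB.toLp := by
  subst h; rfl

theorem toLp_inj (hA : IsHS bas A) (hB : IsHS bas B) : hA.toLp = hB.toLp ↔ A = B := by
  refine ⟨fun h ↦ bas.ext_clm fun i ↦ ?_, toLp_congr hA hB⟩
  rw [← hA.toLp_apply, h, hB.toLp_apply]

theorem toLp_eq_zero (hA : IsHS bas A) : hA.toLp = 0 ↔ A = 0 := by
  refine ⟨fun h ↦ bas.ext_clm fun i ↦ ?_, fun h ↦ ?_⟩
  · rw [← hA.toLp_apply, h]; simp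
  · subst h; ext i; simp

theorem inner_toLp_const_mul (C : 𝓗 →L[ℂ] 𝓗) (hA : IsHS bas A) (hB : IsHS bas B) :
    ⟪(hA.const_mul C).toLp, hB.toLp⟫_ℂ = ⟪hA.toLp, (hB.const_mul (Star.star C)).toLp⟫_ℂ := by
  rw [lp.inner_eq_tsum, lp.inner_eq_tsum]
  refine tsum_congr fun i ↦ ?_
  rw [ContinuousLinearMap.star_eq_adjoint]
  exact (ContinuousLinearMap.adjoint_inner_right C _ _).symm

theorem inner_toLp_mul_const (C : 𝓗 →L[ℂ] 𝓗) (hA : IsHS bas A) (hB : IsHS bas B) :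
    ⟪(hA.mul_const C).toLp, hB.toLp⟫_ℂ = ⟪hA.toLp, (hB.mul_const (Star.star C)).toLp⟫_ℂ := by
  rw [← inner_toLp_star (hA.mul_const C) hB, ← inner_toLp_star hA (hB.mul_const (Star.star C)),
    toLp_congr (hA.mul_const C).star (hA.star.const_mul (Star.star C)) (star_mul _ _),
    toLp_congr (hB.mul_const (Star.star C)).star (hB.star.const_mul C) (by simp)]
  exact (inner_toLp_const_mul C hB.star hA.star).symm

end IsHS

variable (bas) in
/-- A linear map sending Hilbert–Schmidt operators to Hilbert–Schmidt operators, symmetric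
for the Hilbert–Schmidt inner product, is a bounded self-adjoint operator on `ℓ²(ι, 𝓗)`. -/
theorem exists_isSelfAdjoint_toLp (F : (𝓗 →L[ℂ] 𝓗) →ₗ[ℂ] (𝓗 →L[ℂ] 𝓗))
    (hF : ∀ T, IsHS bas T → IsHS bas (F T))
    (hsymm : ∀ A B (hA : IsHS bas A) (hB : IsHS bas B),
      ⟪(hF A hA).toLp, hB.toLp⟫_ℂ = ⟪hA.toLp, (hF B hB).toLp⟫_ℂ) :
    ∃ L : lp (fun _ : ι ↦ 𝓗) 2 →L[ℂ] lp (fun _ : ι ↦ 𝓗) 2, IsSelfAdjoint L ∧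
      ∀ T (hT : IsHS bas T), L hT.toLp = (hF T hT).toLp := by
  choose op hop hop_eq using exists_isHS_toLp_eq (bas := bas)
  have hop_toLp {T} (hT : IsHS bas T) : op hT.toLp = T :=
    ((hop _).toLp_inj hT).1 (hop_eq _)
  have hop_add (X Y) : op (X + Y) = op X + op Y := by
    rw [← (hop _).toLp_inj ((hop X).add (hop Y)), hop_eq]
    conv_lhs => rw [← hop_eq X, ← hop_eq Y]
    rfl
  have hop_smul (c : ℂ) (X) : op (c • X) = c • op X := by
    rw [← (hop _).toLp_inj ((hop X).smul c), hop_eq]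
    conv_lhs => rw [← hop_eq X]
    rfl
  let L : lp (fun _ : ι ↦ 𝓗) 2 →ₗ[ℂ] lp (fun _ : ι ↦ 𝓗) 2 :=
    { toFun X := (hF _ (hop X)).toLp
      map_add' X Y := by
        ext i
        simp [hop_add]
      map_smul' c X := by
        ext i
        simp [hop_smul] }
  have hL : L.IsSymmetric := fun X Y ↦ by
    have := hsymm _ _ (hop X) (hop Y)
    rwa [hop_eq, hop_eq] at this
  refine ⟨⟨L, hL.continuous⟩, ContinuousLinearMap.isSelfAdjoint_iff_isSymmetric.2 hL,
    fun T hT ↦ IsHS.toLp_congr (hF _ (hop _)) (hF T hT) (by rw [hop_toLp])⟩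

variable (bas) in
theorem exists_isSelfAdjoint_toLp_mulLeft {H : 𝓗 →L[ℂ] 𝓗} (hH : IsSelfAdjoint H) :
    ∃ L : lp (fun _ : ι ↦ 𝓗) 2 →L[ℂ] lp (fun _ : ι ↦ 𝓗) 2, IsSelfAdjoint L ∧
      ∀ T (hT : IsHS bas T), L hT.toLp = (hT.const_mul H).toLp :=
  exists_isSelfAdjoint_toLp bas (LinearMap.mulLeft ℂ H) (fun _ hT ↦ hT.const_mul H)
    fun A B hA hB ↦ by
      have := IsHS.inner_toLp_const_mul H hA hB
      rwa [IsHS.toLp_congr (hB.const_mul (star H)) (hB.const_mul H) (by rw [hH.star_eq])] at this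

variable (bas) in
theorem exists_isSelfAdjoint_toLp_mulRight {H : 𝓗 →L[ℂ] 𝓗} (hH : IsSelfAdjoint H) :
    ∃ R : lp (fun _ : ι ↦ 𝓗) 2 →L[ℂ] lp (fun _ : ι ↦ 𝓗) 2, IsSelfAdjoint R ∧
      ∀ T (hT : IsHS bas T), R hT.toLp = (hT.mul_const H).toLp :=
  exists_isSelfAdjoint_toLp bas (LinearMap.mulRight ℂ H) (fun _ hT ↦ hT.mul_const H)
    fun A B hA hB ↦ by
      have := IsHS.inner_toLp_mul_const H hA hB
      rwa [IsHS.toLp_congr (hB.mul_const (star H)) (hB.mul_const H) (by rw [hH.star_eq])] at this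

section Multiplication

variable {H H₀ V : 𝓗 →L[ℂ] 𝓗} {L R : lp (fun _ : ι ↦ 𝓗) 2 →L[ℂ] lp (fun _ : ι ↦ 𝓗) 2}

theorem commute_toLp_mul (hL : ∀ T (hT : IsHS bas T), L hT.toLp = (hT.const_mul H).toLp)
    (hR : ∀ T (hT : IsHS bas T), R hT.toLp = (hT.mul_const H₀).toLp) : Commute L R := by
  refine ContinuousLinearMap.ext fun X ↦ ?_
  obtain ⟨T, hT, rfl⟩ := exists_isHS_toLp_eq (bas := bas) X
  simp only [mul_apply_eq_comp]
  rw [hL, hR, hR, hL]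
  exact IsHS.toLp_congr _ _ (mul_assoc _ _ _).symm

theorem toLp_pow_mul_pow (hL : ∀ T (hT : IsHS bas T), L hT.toLp = (hT.const_mul H).toLp)
    (hR : ∀ T (hT : IsHS bas T), R hT.toLp = (hT.mul_const H₀).toLp) (hV : IsHS bas V) (c m : ℕ) :
    (L ^ c * R ^ m) hV.toLp = ((hV.const_mul (H ^ c)).mul_const (H₀ ^ m)).toLp := by
  have key : (R ^ m) hV.toLp = (hV.mul_const (H₀ ^ m)).toLp := by
    induction m with
    | zero => exact IsHS.toLp_congr hV (hV.mul_const _) (by simp)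
    | succ m ih =>
      rw [pow_succ', mul_apply_eq_comp, ih, hR]
      exact IsHS.toLp_congr _ _ (by rw [pow_succ, mul_assoc])
  rw [mul_apply_eq_comp, key]
  induction c with
  | zero => exact IsHS.toLp_congr (hV.mul_const _) ((hV.const_mul _).mul_const _) (by simp)
  | succ c ih =>
    rw [pow_succ', mul_apply_eq_comp, ih, hL]
    exact IsHS.toLp_congr _ _ (by rw [pow_succ']; simp only [mul_assoc])

/-- If `V = H - H₀` is Hilbert–Schmidt, it is orthogonal to every Hilbert–Schmidt operator `T` with
`H * T = T * H₀`, so it lies in the closure of the range of `T ↦ H * T - T * H₀`. -/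
theorem toLp_mem_closure_range (hH₀ : IsSelfAdjoint H₀) (hH : IsSelfAdjoint H) (hV : V = H - H₀)
    (hVHS : IsHS bas V) (hLsa : IsSelfAdjoint L) (hRsa : IsSelfAdjoint R)
    (hL : ∀ T (hT : IsHS bas T), L hT.toLp = (hT.const_mul H).toLp)
    (hR : ∀ T (hT : IsHS bas T), R hT.toLp = (hT.mul_const H₀).toLp) :
    hVHS.toLp ∈ closure (Set.range (L - R)) := by
  have hVsa : IsSelfAdjoint V := hV ▸ hH.sub hH₀
  have hsa : IsSelfAdjoint (L - R) := hLsa.sub hRsa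
  have hker {T} (hT : IsHS bas T) : hT.toLp ∈ (L - R).ker ↔ H * T = T * H₀ := by
    rw [LinearMap.mem_ker, ContinuousLinearMap.coe_coe, sub_apply, sub_eq_zero,
      hL, hR]
    exact IsHS.toLp_inj _ _
  -- an intertwiner of the form `X X* X` is orthogonal to `V`
  have horth {X} (hX : IsHS bas X) (hHX : H * X = X * H₀) :
      H * (X * (star X * X)) = X * (star X * X) * H₀ ∧
      ⟪hVHS.toLp, (hX.mul_const (star X * X)).toLp⟫_ℂ = 0 := by
    have hX' : H₀ * star X = star X * H := by
      have := congrArg star hHX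
      simpa [hH.star_eq, hH₀.star_eq] using this.symm
    have hB : star X * X * H₀ = H₀ * (star X * X) := by
      rw [mul_assoc, ← hHX, ← mul_assoc, ← hX', mul_assoc]
    have hBHS : IsHS bas (star X * X) := hX.const_mul _
    have hZ : H * (X * (star X * X)) = X * (star X * X) * H₀ := by
      rw [← mul_assoc, hHX, mul_assoc, ← hB]
      simp only [mul_assoc]
    refine ⟨hZ, ?_⟩
    have e1 := IsHS.hasSum_trace_mul hX (hBHS.mul_const H₀)
    have e2 := IsHS.hasSum_trace_mul (hX.const_mul H₀) hBHS
    have e3 : ⟪hX.star.toLp, (hBHS.mul_const H₀).toLp⟫_ℂ =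
        ⟪(hX.const_mul H₀).star.toLp, hBHS.toLp⟫_ℂ := by
      rw [IsHS.toLp_congr (hX.const_mul H₀).star (hX.star.mul_const (star H₀)) (star_mul _ _),
        IsHS.inner_toLp_mul_const (star H₀) hX.star hBHS,
        IsHS.toLp_congr (hBHS.mul_const (star (star H₀))) (hBHS.mul_const H₀) (by rw [star_star])]
    have e4 := e1.sub e2
    rw [e3, sub_self] at e4
    rw [lp.inner_eq_tsum, ← e4.tsum_eq]
    refine tsum_congr fun i ↦ ?_
    rw [← inner_sub_right, ← sub_apply]
    simp only [IsHS.toLp_apply]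
    have : X * (star X * X * H₀) - H₀ * X * (star X * X) = V * (X * (star X * X)) := by
      rw [hV, sub_mul, hZ]; simp only [mul_assoc]
    rw [this]
    exact ContinuousLinearMap.isSelfAdjoint_iff_isSymmetric.1 hVsa _ _
  have hcl : closure (Set.range (L - R)) = ((L - R).kerᗮ : Submodule ℂ _) := by
    have h1 : (L - R).rangeᗮ = (L - R).ker := by
      rw [ContinuousLinearMap.orthogonal_range, ← ContinuousLinearMap.star_eq_adjoint, hsa.star_eq]
    rw [← h1, Submodule.orthogonal_orthogonal_eq_closure, Submodule.topologicalClosure_coe]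
    rfl
  rw [hcl]
  obtain ⟨X, hX, hXeq⟩ := exists_isHS_toLp_eq (bas := bas)
    ((L - R).ker.starProjection hVHS.toLp)
  have hXmem : hX.toLp ∈ (L - R).ker := by
    rw [hXeq]; exact Submodule.starProjection_apply_mem _ _
  obtain ⟨hZ, hVZ⟩ := horth hX ((hker hX).1 hXmem)
  have hXZ : ⟪hX.toLp, (hX.mul_const (star X * X)).toLp⟫_ℂ = 0 := by
    have := Submodule.starProjection_inner_eq_zero (K := (L - R).ker) hVHS.toLp _
      ((hker (hX.mul_const (star X * X))).2 hZ)
    rwa [inner_sub_left, hVZ, ← hXeq, zero_sub, neg_eq_zero] at this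
  have hXX : star X * X = 0 := by
    rw [← (hX.const_mul (star X)).toLp_eq_zero, ← inner_self_eq_zero (𝕜 := ℂ),
      IsHS.inner_toLp_const_mul (star X) hX (hX.const_mul (star X)), ← hXZ,
      IsHS.toLp_congr ((hX.const_mul (star X)).const_mul (star (star X)))
        (hX.mul_const (star X * X)) (by rw [star_star])]
  have hX0 : X = 0 := CStarRing.star_mul_self_eq_zero_iff X |>.1 hXX
  have : (L - R).ker.starProjection hVHS.toLp = 0 := by
    rw [← hXeq, hX.toLp_eq_zero, hX0]
  simpa [Submodule.starProjection_apply_eq_zero_iff] using this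

end Multiplication

/-- The spectrum of a self-adjoint operator lies in `[a, b]` iff its quadratic form does. -/
theorem spectrum_subset_Icc_iff {A : 𝓗 →L[ℂ] 𝓗} (hA : IsSelfAdjoint A) {a b : ℝ} :
    spectrum ℝ A ⊆ Set.Icc a b ↔
      ∀ x, a * ‖x‖ ^ 2 ≤ (⟪x, A x⟫_ℂ).re ∧ (⟪x, A x⟫_ℂ).re ≤ b * ‖x‖ ^ 2 := by
  have hmap (c : ℝ) (x : 𝓗) : (⟪x, algebraMap ℝ (𝓗 →L[ℂ] 𝓗) c x⟫_ℂ).re = c * ‖x‖ ^ 2 := by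
    rw [Algebra.algebraMap_eq_smul_one, smul_apply, one_apply_eq_self,
      RCLike.real_smul_eq_coe_smul (K := ℂ), inner_smul_right, inner_self_eq_norm_sq_to_K]
    simp [← Complex.ofReal_pow]
  have hle {B C : 𝓗 →L[ℂ] 𝓗} (hB : IsSelfAdjoint B) (hC : IsSelfAdjoint C) :
      B ≤ C ↔ ∀ x, (⟪x, B x⟫_ℂ).re ≤ (⟪x, C x⟫_ℂ).re := by
    rw [ContinuousLinearMap.le_def, ContinuousLinearMap.isPositive_def',
      and_iff_right (hC.sub hB)]
    refine forall_congr' fun x ↦ ?_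
    rw [ContinuousLinearMap.reApplyInnerSelf_apply, inner_re_symm, sub_apply, inner_sub_right,
      map_sub, sub_nonneg]
    rfl
  have hc (c : ℝ) : IsSelfAdjoint (algebraMap ℝ (𝓗 →L[ℂ] 𝓗) c) := .algebraMap _ (.all c)
  rw [forall_and, ← Set.Ici_inter_Iic, Set.subset_inter_iff]
  refine and_congr ?_ ?_
  · have := algebraMap_le_iff_le_spectrum (r := a) (a := A)
    rw [hle (hc a) hA] at this
    simp only [hmap] at this
    exact this.symm
  · have := le_algebraMap_iff_spectrum_le (r := b) (a := A)
    rw [hle hA (hc b)] at this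
    simp only [hmap] at this
    exact this.symm

theorem spectrum_subset_Icc_of_sub {H₀ H : 𝓗 →L[ℂ] 𝓗} (hH₀ : IsSelfAdjoint H₀)
    (hH : IsSelfAdjoint H) {a b : ℝ} (h : spectrum ℝ H₀ ⊆ Set.Icc a b) :
    spectrum ℝ H ⊆ Set.Icc (a - ‖H - H₀‖) (b + ‖H - H₀‖) := by
  rw [spectrum_subset_Icc_iff hH₀] at h
  refine (spectrum_subset_Icc_iff hH).2 fun x ↦ ?_
  have h1 : ⟪x, H x⟫_ℂ = ⟪x, H₀ x⟫_ℂ + ⟪x, (H - H₀) x⟫_ℂ := by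
    rw [← inner_add_right, sub_apply, add_sub_cancel]
  have h2 : |(⟪x, (H - H₀) x⟫_ℂ).re| ≤ ‖H - H₀‖ * ‖x‖ ^ 2 :=
    calc |(⟪x, (H - H₀) x⟫_ℂ).re| ≤ ‖⟪x, (H - H₀) x⟫_ℂ‖ := Complex.abs_re_le_norm _
      _ ≤ ‖x‖ * ‖(H - H₀) x‖ := norm_inner_le_norm _ _
      _ ≤ ‖x‖ * (‖H - H₀‖ * ‖x‖) := by gcongr; exact (H - H₀).le_opNorm x
      _ = ‖H - H₀‖ * ‖x‖ ^ 2 := by ring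
  rw [abs_le] at h2
  rw [h1, Complex.add_re]
  constructor <;> linarith [(h x).1, (h x).2]

theorem spectrum_subset_Icc_sInf_sSup (A : 𝓗 →L[ℂ] 𝓗) :
    spectrum ℝ A ⊆ Set.Icc (sInf (spectrum ℝ A)) (sSup (spectrum ℝ A)) := fun _ hx ↦
  ⟨csInf_le (spectrum.isCompact A).bddBelow hx, le_csSup (spectrum.isCompact A).bddAbove hx⟩

theorem IsHS.inner_toLp_const_mul_mem_Icc {H T : 𝓗 →L[ℂ] 𝓗} (hH : IsSelfAdjoint H) {a b : ℝ}
    (h : spectrum ℝ H ⊆ Set.Icc a b) (hT : IsHS bas T) :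
    a * ‖hT.toLp‖ ^ 2 ≤ (⟪hT.toLp, (hT.const_mul H).toLp⟫_ℂ).re ∧
      (⟪hT.toLp, (hT.const_mul H).toLp⟫_ℂ).re ≤ b * ‖hT.toLp‖ ^ 2 := by
  rw [spectrum_subset_Icc_iff hH] at h
  have h1 : HasSum (fun i ↦ ‖T (bas i)‖ ^ 2) (‖hT.toLp‖ ^ 2) := by
    have := Complex.hasSum_re (lp.hasSum_inner (𝕜 := ℂ) hT.toLp hT.toLp)
    rw [inner_self_eq_norm_sq_to_K] at this
    simpa [inner_self_eq_norm_sq_to_K, ← Complex.ofReal_pow] using this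
  have h2 := Complex.hasSum_re (lp.hasSum_inner (𝕜 := ℂ) hT.toLp (hT.const_mul H).toLp)
  exact ⟨hasSum_le (fun i ↦ (h (T (bas i))).1) (h1.mul_left a) h2,
    hasSum_le (fun i ↦ (h (T (bas i))).2) h2 (h1.mul_left b)⟩

section Spectrum

variable {H : 𝓗 →L[ℂ] 𝓗} {L : lp (fun _ : ι ↦ 𝓗) 2 →L[ℂ] lp (fun _ : ι ↦ 𝓗) 2} {a b : ℝ}

theorem spectrum_toLp_mulLeft_subset_Icc (hH : IsSelfAdjoint H) (hLsa : IsSelfAdjoint L)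
    (hL : ∀ T (hT : IsHS bas T), L hT.toLp = (hT.const_mul H).toLp)
    (h : spectrum ℝ H ⊆ Set.Icc a b) : spectrum ℝ L ⊆ Set.Icc a b := by
  refine (spectrum_subset_Icc_iff hLsa).2 fun X ↦ ?_
  obtain ⟨T, hT, rfl⟩ := exists_isHS_toLp_eq (bas := bas) X
  rw [hL]
  exact hT.inner_toLp_const_mul_mem_Icc hH h

theorem spectrum_toLp_mulRight_subset_Icc (hH : IsSelfAdjoint H) (hLsa : IsSelfAdjoint L)
    (hL : ∀ T (hT : IsHS bas T), L hT.toLp = (hT.mul_const H).toLp)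
    (h : spectrum ℝ H ⊆ Set.Icc a b) : spectrum ℝ L ⊆ Set.Icc a b := by
  refine (spectrum_subset_Icc_iff hLsa).2 fun X ↦ ?_
  obtain ⟨T, hT, rfl⟩ := exists_isHS_toLp_eq (bas := bas) X
  have h1 : ‖hT.toLp‖ = ‖hT.star.toLp‖ := by
    rw [norm_eq_sqrt_re_inner (𝕜 := ℂ), norm_eq_sqrt_re_inner (𝕜 := ℂ),
      IsHS.inner_toLp_star hT hT]
  rw [hL, ← IsHS.inner_toLp_star hT (hT.mul_const H),
    IsHS.toLp_congr (hT.mul_const H).star (hT.star.const_mul H) (by rw [star_mul, hH.star_eq]), h1,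
    ← inner_conj_symm, Complex.conj_re]
  exact hT.star.inner_toLp_const_mul_mem_Icc hH h

end Spectrum

/-- An orthonormal family indexed by a Hilbert basis is the image of the basis under an isometry. -/
theorem HilbertBasis.exists_isometry (bas : HilbertBasis ι ℂ 𝓗) {v : ι → 𝓗}
    (hv : Orthonormal ℂ v) :
    ∃ S : 𝓗 →L[ℂ] 𝓗, star S * S = 1 ∧ ∀ i, S (bas i) = v i := by
  classical
  let S : 𝓗 →ₗᵢ[ℂ] 𝓗 := hv.orthogonalFamily.linearIsometry.comp bas.repr.toLinearIsometry
  refine ⟨S.toContinuousLinearMap, ?_, fun i ↦ ?_⟩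
  · rw [ContinuousLinearMap.star_eq_adjoint, ContinuousLinearMap.mul_def,
      ContinuousLinearMap.norm_map_iff_adjoint_comp_self _ |>.1 S.norm_map]
  · change hv.orthogonalFamily.linearIsometry (bas.repr (bas i)) = v i
    rw [bas.repr_self, OrthogonalFamily.linearIsometry_apply_single,
      LinearIsometry.toSpanSingleton_apply, one_smul]

namespace IsTC

variable {S T : 𝓗 →L[ℂ] 𝓗}

theorem smul (c : ℂ) (hT : IsTC bas T) : IsTC bas (c • T) := by
  obtain ⟨A, B, rfl, hA, hB⟩ := hT
  exact ⟨c • A, B, (smul_mul_assoc _ _ _).symm, hA.smul c, hB⟩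

theorem of_finite [Finite ι] (T : 𝓗 →L[ℂ] 𝓗) : IsTC bas T :=
  ⟨T, 1, (mul_one T).symm, Summable.of_finite, Summable.of_finite⟩

theorem add (hS : IsTC bas S) (hT : IsTC bas T) : IsTC bas (S + T) := by
  cases finite_or_infinite ι with
  | inl _ => exact of_finite _
  | inr _ =>
    obtain ⟨A, B, rfl, hA, hB⟩ := hS
    obtain ⟨C, D, rfl, hC, hD⟩ := hT
    obtain ⟨e⟩ : Nonempty (ι ⊕ ι ≃ ι) := Cardinal.eq.1 (by simp)
    obtain ⟨P, hP, hPe⟩ := bas.exists_isometry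
      (bas.orthonormal.comp _ (e.injective.comp Sum.inl_injective))
    obtain ⟨Q, hQ, hQe⟩ := bas.exists_isometry
      (bas.orthonormal.comp _ (e.injective.comp Sum.inr_injective))
    have hPQ : star P * Q = 0 := by
      refine bas.ext_clm fun j ↦ bas.repr.injective ?_
      ext i
      rw [bas.repr_apply_apply, mul_apply_eq_comp, ContinuousLinearMap.star_eq_adjoint,
        ContinuousLinearMap.adjoint_inner_right, hPe, hQe]
      simp [bas.orthonormal.inner_eq_zero]
    have hQP : star Q * P = 0 := by simpa using congrArg star hPQ
    refine ⟨A * star P + C * star Q, P * B + Q * D, ?_, (hA.mul_const _).add (hC.mul_const _),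
      (hB.const_mul _).add (hD.const_mul _)⟩
    have h1 (X Y Z W : 𝓗 →L[ℂ] 𝓗) : X * Y * (Z * W) = X * (Y * Z) * W := by
      simp only [mul_assoc]
    simp [add_mul, mul_add, h1, hP, hQ, hPQ, hQP]

theorem zero : IsTC bas (0 : 𝓗 →L[ℂ] 𝓗) :=
  ⟨0, 0, (mul_zero _).symm, by simp [IsHS], by simp [IsHS]⟩

theorem sum {κ : Type*} {s : Finset κ} {f : κ → 𝓗 →L[ℂ] 𝓗} (h : ∀ k ∈ s, IsTC bas (f k)) :
    IsTC bas (∑ k ∈ s, f k) :=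
  Finset.sum_induction _ _ (fun _ _ ↦ add) zero h

end IsTC

theorem hasSum_trace_pow_mul_pow {H H₀ V : 𝓗 →L[ℂ] 𝓗} (hH₀ : IsSelfAdjoint H₀)
    (hV : IsSelfAdjoint V) (hVHS : IsHS bas V) (c m d : ℕ) :
    HasSum (fun i ↦ ⟪bas i, (H₀ ^ m * V * (H ^ c * V * H₀ ^ d)) (bas i)⟫_ℂ)
      ⟪hVHS.toLp, ((hVHS.const_mul (H ^ c)).mul_const (H₀ ^ (m + d))).toLp⟫_ℂ := by
  have hHm : star (H₀ ^ m) = H₀ ^ m := (hH₀.pow m).star_eq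
  have hV2 := (hVHS.const_mul (H ^ c)).mul_const (H₀ ^ d)
  convert IsHS.hasSum_trace_mul (hVHS.const_mul (H₀ ^ m)) hV2 using 1
  rw [IsHS.toLp_congr (hVHS.const_mul (H₀ ^ m)).star (hVHS.mul_const (H₀ ^ m))
      (by rw [star_mul, hV.star_eq, hHm]), IsHS.inner_toLp_mul_const (H₀ ^ m) hVHS hV2,
    IsHS.toLp_congr (hV2.mul_const (star (H₀ ^ m)))
      ((hVHS.const_mul (H ^ c)).mul_const (H₀ ^ (m + d)))
      (by rw [hHm, mul_assoc, ← pow_add, add_comm])]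

theorem aeval_sub_aeval_sub_polyDeriv_eq {H H₀ V : 𝓗 →L[ℂ] 𝓗} (hV : V = H - H₀)
    (p : Polynomial ℂ) :
    Polynomial.aeval H p - Polynomial.aeval H₀ p - polyDeriv p H₀ V =
      ∑ r ∈ p.support, p.coeff r • ∑ j ∈ Finset.range r, ∑ c ∈ Finset.range j,
        H₀ ^ (r - j - 1) * V * (H ^ c * V * H₀ ^ (j - c - 1)) := by
  subst hV
  exact aeval_sub_aeval_sub_sum_eq p H H₀

theorem IsHS.isTC_aeval_sub_aeval_sub_polyDeriv {H H₀ V : 𝓗 →L[ℂ] 𝓗} (hV : V = H - H₀)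
    (hVHS : IsHS bas V) (p : Polynomial ℂ) :
    IsTC bas (Polynomial.aeval H p - Polynomial.aeval H₀ p - polyDeriv p H₀ V) := by
  rw [aeval_sub_aeval_sub_polyDeriv_eq hV]
  exact .sum fun r _ ↦ .smul _ <| .sum fun j _ ↦ .sum fun c _ ↦
    ⟨_, _, rfl, hVHS.const_mul _, (hVHS.const_mul _).mul_const _⟩

/-- The trace formula in terms of the joint spectral measure at `V` of left multiplication by `H`
and right multiplication by `H₀`. -/
theorem IsHS.exists_measure_traceAlong_eq {H H₀ V : 𝓗 →L[ℂ] 𝓗} (hH₀ : IsSelfAdjoint H₀)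
    (hH : IsSelfAdjoint H) (hV : V = H - H₀) (hVHS : IsHS bas V) {a b : ℝ}
    (hHs : spectrum ℝ H ⊆ Set.Icc a b) (hH₀s : spectrum ℝ H₀ ⊆ Set.Icc a b) :
    ∃ ν : Measure (ℝ × ℝ), IsFiniteMeasure ν ∧
      (∀ᵐ z ∂ν, z.1 ∈ Set.Icc a b ∧ z.2 ∈ Set.Icc a b ∧ z.1 ≠ z.2) ∧
      ν.real Set.univ = hsNorm bas V ^ 2 ∧
      ∀ p : Polynomial ℂ,
        traceAlong bas (Polynomial.aeval H p - Polynomial.aeval H₀ p - polyDeriv p H₀ V) =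
          ∫ z, (∫ t in (0 : ℝ)..1, (1 - t) * p.derivative.derivative.eval
            ((z.2 + t * (z.1 - z.2) : ℝ) : ℂ)) ∂ν := by
  obtain ⟨L, hLsa, hL⟩ := exists_isSelfAdjoint_toLp_mulLeft bas hH
  obtain ⟨R, hRsa, hR⟩ := exists_isSelfAdjoint_toLp_mulRight bas hH₀
  obtain ⟨ν, hνfin, hν, hmom⟩ := exists_joint_spectral_measure hLsa hRsa (commute_toLp_mul hL hR)
    (toLp_mem_closure_range hH₀ hH hV hVHS hLsa hRsa hL hR)
    (spectrum_toLp_mulLeft_subset_Icc hH hLsa hL hHs)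
    (spectrum_toLp_mulRight_subset_Icc hH₀ hRsa hR hH₀s)
  refine ⟨ν, hνfin, hν, ?_, fun p ↦ ?_⟩
  · have h := hmom 0 0
    rw [pow_zero, pow_zero, one_mul, one_apply_eq_self, ← hVHS.hsNorm_sq] at h
    simpa [← Complex.ofReal_pow] using h
  have hint (c m : ℕ) : Integrable (fun z : ℝ × ℝ ↦ (z.1 : ℂ) ^ c * (z.2 : ℂ) ^ m) ν := by
    refine .of_bound (by fun_prop) (max |a| |b| ^ c * max |a| |b| ^ m) ?_
    filter_upwards [hν] with z hz
    rw [norm_mul, norm_pow, norm_pow, Complex.norm_real, Complex.norm_real]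
    gcongr
    · exact abs_le_max_abs_abs hz.1.1 hz.1.2
    · exact abs_le_max_abs_abs hz.2.1.1 hz.2.1.2
  have hterm (c m d : ℕ) :
      HasSum (fun i ↦ ⟪bas i, (H₀ ^ m * V * (H ^ c * V * H₀ ^ d)) (bas i)⟫_ℂ)
        (∫ z : ℝ × ℝ, (z.1 : ℂ) ^ c * (z.2 : ℂ) ^ (m + d) ∂ν) := by
    have := hasSum_trace_pow_mul_pow (H := H) hH₀ (hV ▸ hH.sub hH₀) hVHS c m d
    rw [← toLp_pow_mul_pow hL hR hVHS, ← hmom, ← integral_complex_ofReal] at this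
    simpa using this
  have hsum : HasSum (fun i ↦ ⟪bas i,
      (Polynomial.aeval H p - Polynomial.aeval H₀ p - polyDeriv p H₀ V) (bas i)⟫_ℂ)
      (∫ z : ℝ × ℝ, ∑ r ∈ p.support, p.coeff r * ∑ j ∈ Finset.range r, ∑ c ∈ Finset.range j,
        (z.1 : ℂ) ^ c * (z.2 : ℂ) ^ (r - j - 1 + (j - c - 1)) ∂ν) := by
    rw [aeval_sub_aeval_sub_polyDeriv_eq hV]
    have hint' (r j : ℕ) : Integrable (fun z : ℝ × ℝ ↦ ∑ c ∈ Finset.range j,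
        (z.1 : ℂ) ^ c * (z.2 : ℂ) ^ (r - j - 1 + (j - c - 1))) ν :=
      integrable_finsetSum _ fun c _ ↦ hint _ _
    rw [integral_finsetSum _ fun r _ ↦
      (integrable_finsetSum _ fun j _ ↦ hint' r j).const_mul _]
    simp only [sum_apply, smul_apply, inner_sum, inner_smul_right]
    refine hasSum_sum fun r _ ↦ ?_
    rw [integral_const_mul, integral_finsetSum _ fun j _ ↦ hint' r j]
    refine HasSum.mul_left _ (hasSum_sum fun j _ ↦ ?_)
    rw [integral_finsetSum _ fun c _ ↦ hint _ _]
    exact hasSum_sum fun c _ ↦ hterm _ _ _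
  rw [traceAlong, hsum.tsum_eq]
  refine integral_congr_ae ?_
  filter_upwards [hν] with z hz
  have hz' : ((z.1 : ℂ) - z.2) ^ 2 ≠ 0 :=
    pow_ne_zero 2 (sub_ne_zero.2 (Complex.ofReal_injective.ne hz.2.2))
  exact mul_left_cancel₀ hz' ((sub_sq_mul_sum_eq p z.1 z.2).trans
    (integral_one_sub_mul_derivative_derivative p z.1 z.2).symm)

end HilbertSchmidt

theorem exists_derivative_derivative_eq (q : Polynomial ℂ) :
    ∃ p : Polynomial ℂ, p.derivative.derivative = q := by
  have h (q : Polynomial ℂ) : ∃ p : Polynomial ℂ, p.derivative = q := by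
    induction q using Polynomial.induction_on' with
    | add q₁ q₂ h₁ h₂ =>
      obtain ⟨p₁, rfl⟩ := h₁
      obtain ⟨p₂, rfl⟩ := h₂
      exact ⟨p₁ + p₂, Polynomial.derivative_add⟩
    | monomial n c =>
      refine ⟨.monomial (n + 1) (c / (n + 1)), ?_⟩
      rw [Polynomial.derivative_monomial]
      push_cast
      rw [div_mul_cancel₀ _ (by exact_mod_cast n.succ_ne_zero)]
  obtain ⟨p₁, rfl⟩ := h q
  obtain ⟨p, rfl⟩ := h p₁
  exact ⟨p, rfl⟩

/-- Koplienko trace formula, bounded case. For bounded self-adjoint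
`H₀, H` on a separable infinite-dimensional Hilbert space with `V = H − H₀` Hilbert–Schmidt,
`p(H) − p(H₀) − Dp(H₀)·V` is trace class for every polynomial `p`, and with
`a = inf σ(H₀) − ‖V‖`, `b = sup σ(H₀) + ‖V‖` there is a (a.e. unique) non-negative
`η ∈ L¹([a,b])` with `Tr(p(H) − p(H₀) − Dp(H₀)·V) = ∫_a^b p''(λ) η(λ) dλ` for all `p`, and
`∫_a^b η = ½‖V‖₂²`. -/
theorem stmt_19 {𝓗 : Type*} [NormedAddCommGroup 𝓗] [InnerProductSpace ℂ 𝓗] [CompleteSpace 𝓗]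
    {ι : Type*} (bas : HilbertBasis ι ℂ 𝓗)
    (H₀ H V : 𝓗 →L[ℂ] 𝓗) (hH₀ : IsSelfAdjoint H₀) (hH : IsSelfAdjoint H)
    (hV : V = H - H₀) (hVHS : IsHS bas V)
    (a b : ℝ) (ha : a = sInf (spectrum ℝ H₀) - ‖V‖) (hb : b = sSup (spectrum ℝ H₀) + ‖V‖) :
    (∀ p : Polynomial ℂ,
      IsTC bas (Polynomial.aeval H p - Polynomial.aeval H₀ p - polyDeriv p H₀ V)) ∧
    ∃ η : ℝ → ℝ,
      ((∀ lam, 0 ≤ η lam) ∧ Function.support η ⊆ Set.Icc a b ∧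
        MeasureTheory.IntegrableOn η (Set.Icc a b) ∧
        (∀ p : Polynomial ℂ,
          traceAlong bas (Polynomial.aeval H p - Polynomial.aeval H₀ p - polyDeriv p H₀ V) =
            ∫ lam in a..b,
              Polynomial.eval (lam : ℂ) (Polynomial.derivative (Polynomial.derivative p)) *
                (η lam : ℂ)) ∧
        (∫ lam in a..b, η lam) = (1 / 2) * hsNorm bas V ^ 2) ∧
      ∀ η' : ℝ → ℝ,
        ((∀ lam, 0 ≤ η' lam) ∧ Function.support η' ⊆ Set.Icc a b ∧
          MeasureTheory.IntegrableOn η' (Set.Icc a b) ∧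
          (∀ p : Polynomial ℂ,
            traceAlong bas (Polynomial.aeval H p - Polynomial.aeval H₀ p - polyDeriv p H₀ V) =
              ∫ lam in a..b,
                Polynomial.eval (lam : ℂ) (Polynomial.derivative (Polynomial.derivative p)) *
                  (η' lam : ℂ)) ∧
          (∫ lam in a..b, η' lam) = (1 / 2) * hsNorm bas V ^ 2) →
        η' =ᵐ[MeasureTheory.volume.restrict (Set.Icc a b)] η := by
  have hH₀s := spectrum_subset_Icc_sInf_sSup H₀
  have hHs : spectrum ℝ H ⊆ Set.Icc a b := by
    rw [ha, hb, hV]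
    exact spectrum_subset_Icc_of_sub hH₀ hH hH₀s
  have hab : a ≤ b := by
    have := Real.sInf_le_sSup _ (spectrum.isCompact H₀).bddBelow (spectrum.isCompact H₀).bddAbove
    rw [ha, hb]
    linarith [norm_nonneg V]
  have hH₀s' : spectrum ℝ H₀ ⊆ Set.Icc a b := hH₀s.trans
    (Set.Icc_subset_Icc (by linarith [norm_nonneg V]) (by linarith [norm_nonneg V]))
  have hIcc {E : Type} [NormedAddCommGroup E] [NormedSpace ℝ E] (f : ℝ → E) :
      ∫ x in a..b, f x = ∫ x in Set.Icc a b, f x := by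
    rw [intervalIntegral.integral_of_le hab, integral_Icc_eq_integral_Ioc]
  obtain ⟨ν, _, hν, hνuniv, htrace⟩ :=
    hVHS.exists_measure_traceAlong_eq hH₀ hH hV hHs hH₀s'
  obtain ⟨η, hη, hηsupp, hηint, hηeq⟩ := exists_density_of_segment_average ν hν
  refine ⟨hVHS.isTC_aeval_sub_aeval_sub_polyDeriv hV, η,
    ⟨hη, hηsupp, hηint, fun p ↦ ?_, ?_⟩, ?_⟩
  · rw [htrace, hIcc]
    exact (hηeq (fun x ↦ p.derivative.derivative.eval (x : ℂ)) (by fun_prop)).symm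
  · have h := hηeq (fun _ ↦ 1) continuous_const
    have h1 : ∫ t in (0 : ℝ)..1, ((1 : ℂ) - t) = 1 / 2 := by
      rw [intervalIntegral.integral_sub (by simp)
        (Complex.continuous_ofReal.intervalIntegrable _ _), intervalIntegral.integral_ofReal]
      simp
      norm_num
    simp only [one_mul, mul_one, h1, integral_const, hνuniv] at h
    rw [hIcc, ← Complex.ofReal_inj, ← integral_complex_ofReal, h]
    simp
    ring
  · rintro η' ⟨-, -, hη'int, hη'trace, -⟩
    refine ae_eq_of_forall_integral_polynomial_eq hη'int hηint fun q ↦ ?_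
    obtain ⟨p, hp⟩ := exists_derivative_derivative_eq (q.map (algebraMap ℝ ℂ))
    have hq (u : ℝ → ℝ) : ((∫ x in Set.Icc a b, q.eval x * u x : ℝ) : ℂ) =
        ∫ x in Set.Icc a b, p.derivative.derivative.eval (x : ℂ) * (u x : ℂ) := by
      rw [← integral_complex_ofReal, hp]
      congr! with x
      rw [Complex.ofReal_mul, ← Complex.coe_algebraMap, Polynomial.eval_map_apply]
    rw [← Complex.ofReal_inj, hq, hq, ← hIcc, ← hη'trace, htrace]
    exact (hηeq (fun x ↦ p.derivative.derivative.eval (x : ℂ)) (by fun_prop)).symm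
end
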